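/- Assume that the conjugacy class c_{p+1} has n distinct eigenvalues. Let (B₁,…,B_{p+1}) be a tuple of n×n complex matrices such that B_j lies in the topological closure of c_j for each j and B₁+…+B_{p+1} = 0. Then (B₁,…,B_{p+1}) lies in the topological closure of V(c₁,…,c_{p+1}) in (gl(n,ℂ))^{p+1}; i.e., a tuple of matrices from the algebraic closure of V(c₁,…,c_{p+1}) can be continuously deformed into one from V(c₁,…,c_{p+1}). -/

import Mathlib

open Matrix Polynomial BigOperators Finset

noncomputable section

def commSubmodule (N : Type*) [Fintype N] (A : Matrix N N ℂ) :
    Submodule ℂ (Matrix N N ℂ) where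
  carrier := {X | X * A = A * X}
  add_mem' := by
    intro X Y hX hY
    simp only [Set.mem_setOf_eq] at *
    rw [Matrix.add_mul, Matrix.mul_add, hX, hY]
  zero_mem' := by
    simp only [Set.mem_setOf_eq, Matrix.zero_mul, Matrix.mul_zero]
  smul_mem' := by
    intro c X hX
    simp only [Set.mem_setOf_eq] at *
    rw [Matrix.smul_mul, Matrix.mul_smul, hX]

/-- `d` of a matrix: `n² - dim of centralizer`. -/
def dQ {N : Type*} [Fintype N] (A : Matrix N N ℂ) : ℕ :=
  Fintype.card N ^ 2 - Module.finrank ℂ (commSubmodule N A)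

/-- `r` of a matrix: the minimum over `μ` of `rank (A - μ • 1)`. -/
def rQ {N : Type*} [Fintype N] [DecidableEq N] (A : Matrix N N ℂ) : ℕ :=
  sInf {k | ∃ μ : ℂ, (A - μ • (1 : Matrix N N ℂ)).rank = k}

/-- The conjugacy class of a matrix under `GL(n, ℂ)`-conjugation. -/
def conjClass {n : ℕ} (A : Matrix (Fin n) (Fin n) ℂ) : Set (Matrix (Fin n) (Fin n) ℂ) :=
  {B | ∃ g : (Matrix (Fin n) (Fin n) ℂ)ˣ, B = (g : Matrix (Fin n) (Fin n) ℂ) * A * (↑g⁻¹ : Matrix (Fin n) (Fin n) ℂ)}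

/-- The conjugacy class of an element of `GL(n, ℂ)`. -/
def conjClassU {n : ℕ} (M : (Matrix (Fin n) (Fin n) ℂ)ˣ) : Set ((Matrix (Fin n) (Fin n) ℂ)ˣ) :=
  {N | ∃ g, N = g * M * g⁻¹}

/-- Irreducibility of a tuple: no common invariant subspace other than `⊥` and `⊤`. -/
def IrredTuple {N : Type*} [Fintype N] {q : ℕ} (A : Fin q → Matrix N N ℂ) : Prop :=
  ∀ U : Submodule ℂ (N → ℂ), (∀ j, ∀ v ∈ U, (A j).mulVec v ∈ U) → U = ⊥ ∨ U = ⊤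

/-- Trivial centralizer of a tuple: only scalar matrices commute with all members. -/
def TrivCent {N : Type*} [Fintype N] [DecidableEq N] {q : ℕ} (A : Fin q → Matrix N N ℂ) : Prop :=
  ∀ X : Matrix N N ℂ, (∀ j, X * A j = A j * X) → ∃ κ : ℂ, X = κ • (1 : Matrix N N ℂ)

/-- A matrix has `n` distinct eigenvalues. -/
def HasDistinctEigen {n : ℕ} (A : Matrix (Fin n) (Fin n) ℂ) : Prop :=
  ∃ ev : Fin n → ℂ, Function.Injective ev ∧
    A.charpoly = ∏ i, (Polynomial.X - Polynomial.C (ev i))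

/-- The variety 𝒱(c₁,…,c_{q}) where `c_j` is the conjugacy class of `A j`. -/
def Vset {n q : ℕ} (A : Fin q → Matrix (Fin n) (Fin n) ℂ) :
    Set (Fin q → Matrix (Fin n) (Fin n) ℂ) :=
  {B | (∀ j, B j ∈ conjClass (A j)) ∧ ∑ j, B j = 0}

/-- The variety 𝒲(C₁,…,C_q) where `C_j` is the conjugacy class of `M j` in `GL(n,ℂ)`. -/
def Wset {n q : ℕ} (M : Fin q → (Matrix (Fin n) (Fin n) ℂ)ˣ) :
    Set (Fin q → (Matrix (Fin n) (Fin n) ℂ)ˣ) :=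
  {B | (∀ j, B j ∈ conjClassU (M j)) ∧ (List.ofFn B).prod = 1}

section JordanChains

variable {V : Type*} [AddCommGroup V] [Module ℂ V]

/-- The vectors `v i` generate `V` under `T`, each `v i` is killed by `(T - lam i) ^ e i`, and the
lengths `e i` add up to the dimension of `V`: so `V` is the direct sum of the Jordan chains
`(T - lam i) ^ q (v i)`, `q < e i`. Chains of length zero are allowed. -/
structure IsJordanSystem (T : Module.End ℂ V) {ι : Type*} [Fintype ι] (v : ι → V) (lam : ι → ℂ)
    (e : ι → ℕ) : Prop where
  pow_apply : ∀ i, ((T - lam i • 1) ^ e i) (v i) = 0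
  sum_eq : ∑ i, e i = Module.finrank ℂ V
  generates : ∀ W : Submodule ℂ V, (∀ w ∈ W, T w ∈ W) → (∀ i, v i ∈ W) → W = ⊤

namespace IsJordanSystem

variable {T : Module.End ℂ V} {ι : Type*} [Fintype ι] {v : ι → V} {lam : ι → ℂ} {e : ι → ℕ}

/-- The vectors of the Jordan chains. -/
def chain (T : Module.End ℂ V) (v : ι → V) (lam : ι → ℂ) (e : ι → ℕ) (p : Σ i, Fin (e i)) : V :=
  ((T - lam p.1 • 1) ^ (p.2 : ℕ)) (v p.1)

lemma pow_apply_of_le (h : IsJordanSystem T v lam e) {i : ι} {q : ℕ} (hq : e i ≤ q) :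
    ((T - lam i • 1) ^ q) (v i) = 0 := by
  obtain ⟨r, rfl⟩ := Nat.exists_eq_add_of_le hq
  rw [add_comm, pow_add, Module.End.mul_apply, h.pow_apply, map_zero]

lemma apply_pow (T : Module.End ℂ V) (l : ℂ) (q : ℕ) (x : V) :
    T (((T - l • 1) ^ q) x) = l • ((T - l • 1) ^ q) x + ((T - l • 1) ^ (q + 1)) x := by
  rw [pow_succ', Module.End.mul_apply]
  simp

lemma span_chain (h : IsJordanSystem T v lam e) :
    Submodule.span ℂ (Set.range (chain T v lam e)) = ⊤ := by
  have hmem : ∀ (i : ι) (q : ℕ), ((T - lam i • 1) ^ q) (v i) ∈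
      Submodule.span ℂ (Set.range (chain T v lam e)) := by
    intro i q
    by_cases hq : q < e i
    · exact Submodule.subset_span ⟨⟨i, q, hq⟩, rfl⟩
    · rw [h.pow_apply_of_le (not_lt.1 hq)]
      exact zero_mem _
  apply h.generates
  · intro w hw
    induction hw using Submodule.span_induction with
    | mem x hx =>
      obtain ⟨p, rfl⟩ := hx
      rw [chain, apply_pow]
      exact add_mem (Submodule.smul_mem _ _ (hmem _ _)) (hmem _ _)
    | zero => simp
    | add x y _ _ hx hy => rw [map_add]; exact add_mem hx hy
    | smul a x _ hx => rw [map_smul]; exact Submodule.smul_mem _ _ hx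
  · intro i
    simpa using hmem i 0

/-- The basis consisting of the vectors of the chains. -/
def basis (h : IsJordanSystem T v lam e) : Module.Basis (Σ i, Fin (e i)) ℂ V :=
  basisOfTopLeSpanOfCardEqFinrank (chain T v lam e) h.span_chain.ge (by simp [h.sum_eq])

lemma basis_apply (h : IsJordanSystem T v lam e) (p : Σ i, Fin (e i)) :
    h.basis p = ((T - lam p.1 • 1) ^ (p.2 : ℕ)) (v p.1) := by
  simp [basis, chain]

lemma mem_range_of_ne {l μ : ℂ} (hne : l ≠ μ) {x : V} {k : ℕ} (hx : ((T - l • 1) ^ k) x = 0)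
    (i : ℕ) : x ∈ LinearMap.range ((T - μ • 1) ^ i) := by
  have hc : IsCoprime ((X - C l : ℂ[X]) ^ k) ((X - C μ) ^ i) :=
    (isCoprime_X_sub_C_of_isUnit_sub (sub_ne_zero.2 hne).isUnit).pow
  obtain ⟨a, b, hab⟩ := hc
  have hX : ∀ c : ℂ, aeval T (X - C c) = T - c • 1 := by
    intro c
    simp [Algebra.algebraMap_eq_smul_one]
  have := congrArg (fun P => aeval T P x) hab
  simp only [map_add, map_mul, map_pow, hX, map_one, Module.End.one_apply, LinearMap.add_apply,
    Module.End.mul_apply, hx, map_zero, zero_add] at this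
  refine ⟨aeval T b x, ?_⟩
  conv_rhs => rw [← this]
  rw [← hX, ← map_pow, ← Module.End.mul_apply, ← Module.End.mul_apply, ← map_mul,
    ← map_mul, mul_comm]

variable [FiniteDimensional ℂ V]

lemma finrank_range_le (h : IsJordanSystem T v lam e) (μ : ℂ) (i : ℕ) :
    Module.finrank ℂ (LinearMap.range ((T - μ • 1) ^ i)) ≤
      ∑ j, if lam j = μ then e j - i else e j := by
  classical
  let m : ι → ℕ := fun j => if lam j = μ then e j - i else e j
  let f : (Σ j, Fin (m j)) → V := fun p =>
    ((T - μ • 1) ^ i) (((T - lam p.1 • 1) ^ (p.2 : ℕ)) (v p.1))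
  have hle : LinearMap.range ((T - μ • 1) ^ i) ≤ Submodule.span ℂ (Set.range f) := by
    rw [LinearMap.range_eq_map, ← h.span_chain, Submodule.map_span, Submodule.span_le]
    rintro _ ⟨_, ⟨⟨j, q⟩, rfl⟩, rfl⟩
    by_cases hq : (q : ℕ) < m j
    · exact Submodule.subset_span ⟨⟨j, q, hq⟩, rfl⟩
    · have hj : lam j = μ := by
        by_contra hne
        simp only [m, if_neg hne] at hq
        exact hq q.2
      simp only [m, if_pos hj] at hq
      have : ((T - μ • 1) ^ i) (chain T v lam e ⟨j, q⟩) = 0 := by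
        simp only [chain]
        rw [← hj, ← Module.End.mul_apply, ← pow_add]
        exact h.pow_apply_of_le (by omega)
      rw [this]
      exact zero_mem _
  calc _ ≤ Module.finrank ℂ (Submodule.span ℂ (Set.range f)) := Submodule.finrank_mono hle
    _ ≤ Fintype.card (Σ j, Fin (m j)) := finrank_range_le_card f
    _ = _ := by simp [m]

lemma le_finrank_range (h : IsJordanSystem T v lam e) (μ : ℂ) (i : ℕ) :
    ∑ j, (if lam j = μ then e j - i else e j) ≤
      Module.finrank ℂ (LinearMap.range ((T - μ • 1) ^ i)) := by
  classical
  let m : ι → ℕ := fun j => if lam j = μ then min i (e j) else 0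
  let f : (Σ j, Fin (m j)) → V := fun p => ((T - lam p.1 • 1) ^ (p.2 : ℕ)) (v p.1)
  have hle : (⊤ : Submodule ℂ V) ≤
      LinearMap.range ((T - μ • 1) ^ i) ⊔ Submodule.span ℂ (Set.range f) := by
    rw [← h.span_chain, Submodule.span_le]
    rintro _ ⟨⟨j, q⟩, rfl⟩
    by_cases hj : lam j = μ
    · by_cases hq : (q : ℕ) < i
      · refine Submodule.mem_sup_right (Submodule.subset_span ⟨⟨j, q, ?_⟩, rfl⟩)
        simp only [m, if_pos hj]
        exact lt_min hq q.2
      · refine Submodule.mem_sup_left ⟨((T - μ • 1) ^ ((q : ℕ) - i)) (v j), ?_⟩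
        rw [← Module.End.mul_apply, ← pow_add, chain, hj, Nat.add_sub_cancel' (not_lt.1 hq)]
    · refine Submodule.mem_sup_left (mem_range_of_ne (k := e j) hj ?_ i)
      rw [chain, ← Module.End.mul_apply, ← pow_add]
      exact h.pow_apply_of_le (by simp)
  have h1 : Module.finrank ℂ V ≤ Module.finrank ℂ (LinearMap.range ((T - μ • 1) ^ i)) +
      Fintype.card (Σ j, Fin (m j)) := by
    rw [← finrank_top ℂ V]
    exact (Submodule.finrank_mono hle).trans <|
      (Submodule.finrank_add_le_finrank_add_finrank _ _).trans
      (Nat.add_le_add_left (finrank_range_le_card f) _)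
  have h2 : ∑ j, (if lam j = μ then e j - i else e j) + ∑ j, m j = ∑ j, e j := by
    rw [← Finset.sum_add_distrib]
    refine Finset.sum_congr rfl fun j _ => ?_
    simp only [m]
    split_ifs <;> omega
  rw [← h.sum_eq, ← h2, Fintype.card_sigma] at h1
  simpa using h1

/-- The rank of a power of `T - μ` in terms of the chain lengths. -/
lemma finrank_range (h : IsJordanSystem T v lam e) (μ : ℂ) (i : ℕ) :
    Module.finrank ℂ (LinearMap.range ((T - μ • 1) ^ i)) =
      ∑ j, if lam j = μ then e j - i else e j :=
  (h.finrank_range_le μ i).antisymm (h.le_finrank_range μ i)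

end IsJordanSystem

end JordanChains

section JordanExistence

variable {V : Type*} [AddCommGroup V] [Module ℂ V]

lemma aeval_apply_mem {T : Module.End ℂ V} {W : Submodule ℂ V} (hW : ∀ w ∈ W, T w ∈ W)
    (P : ℂ[X]) {w : V} (hw : w ∈ W) : aeval T P w ∈ W := by
  induction P using Polynomial.induction_on' with
  | add P Q hP hQ => rw [map_add]; exact add_mem hP hQ
  | monomial k a =>
    rw [aeval_monomial, Algebra.algebraMap_eq_smul_one, smul_mul_assoc, one_mul]
    refine Submodule.smul_mem _ _ ?_
    induction k with
    | zero => simpa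
    | succ k ih => rw [pow_succ']; exact hW _ ih

lemma natDegree_eq_one_of_irreducible_complex {P : ℂ[X]} (hP : Irreducible P) :
    P.natDegree = 1 :=
  natDegree_eq_of_degree_eq_some (IsAlgClosed.degree_eq_one_of_irreducible ℂ hP)

lemma exists_X_sub_C_pow_eq_mul {P : ℂ[X]} (hP : Irreducible P) :
    ∃ l : ℂ, ∀ k : ℕ, ∃ Q : ℂ[X], (X - C l) ^ k = Q * P ^ k := by
  obtain ⟨l, hl⟩ := IsAlgClosed.exists_root P
    (by rw [IsAlgClosed.degree_eq_one_of_irreducible ℂ hP]; exact one_ne_zero)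
  have := (irreducible_X_sub_C l).associated_of_dvd hP (dvd_iff_isRoot.2 hl)
  refine ⟨l, fun k => ?_⟩
  obtain ⟨Q, hQ⟩ := pow_dvd_pow_of_dvd this.symm.dvd k
  exact ⟨Q, by rw [hQ, mul_comm]⟩

open scoped DirectSum in
/-- Every endomorphism of a finite-dimensional complex vector space has a Jordan system. -/
theorem exists_isJordanSystem [FiniteDimensional ℂ V] (T : Module.End ℂ V) :
    ∃ (ι : Type) (_ : Fintype ι) (v : ι → V) (lam : ι → ℂ) (e : ι → ℕ),
      IsJordanSystem T v lam e := by
  classical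
  obtain ⟨ι, _, P, hP, e, ⟨Φ⟩⟩ := Module.equiv_directSum_of_isTorsion
    (Module.AEval.isTorsion_of_finiteDimensional ℂ V T)
  choose lam hlam using fun i => exists_X_sub_C_pow_eq_mul (hP i)
  let of := Module.AEval.of ℂ V T
  let g : ∀ i, ⨁ i, ℂ[X] ⧸ ℂ[X] ∙ P i ^ e i :=
    fun i => DirectSum.lof ℂ[X] ι (fun i => ℂ[X] ⧸ ℂ[X] ∙ P i ^ e i) i (Submodule.Quotient.mk 1)
  let v : ι → V := fun i => of.symm (Φ.symm (g i))
  have hsmul : ∀ i (Q : ℂ[X]), Φ.symm (Q • g i) = of (aeval T Q (v i)) := by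
    intro i Q
    rw [map_smul]
    rfl
  have hmk : ∀ i (Q : ℂ[X]), Q • g i =
      DirectSum.lof ℂ[X] ι (fun i => ℂ[X] ⧸ ℂ[X] ∙ P i ^ e i) i (Submodule.Quotient.mk Q) := by
    intro i Q
    rw [← map_smul, ← Submodule.Quotient.mk_smul, smul_eq_mul, mul_one]
  refine ⟨ι, inferInstance, v, lam, e, ?_, ?_, ?_⟩
  · intro i
    have h1 : aeval T ((X - C (lam i)) ^ e i) = (T - lam i • 1) ^ e i := by
      simp [Algebra.algebraMap_eq_smul_one]
    rw [← h1]
    apply of.injective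
    rw [← hsmul, hmk, map_zero]
    obtain ⟨Q, hQ⟩ := hlam i (e i)
    rw [(Submodule.Quotient.mk_eq_zero _).2, map_zero, map_zero]
    rw [hQ, ← smul_eq_mul]
    exact Submodule.smul_mem _ _ (Submodule.mem_span_singleton_self _)
  · have e1 : V ≃ₗ[ℂ] (⨁ i, ℂ[X] ⧸ ℂ[X] ∙ P i ^ e i) := of.trans (Φ.restrictScalars ℂ)
    have hdim : ∀ i, Module.finrank ℂ (ℂ[X] ⧸ ℂ[X] ∙ P i ^ e i) = e i := by
      intro i
      have := finrank_quotient_span_eq_natDegree (K := ℂ) (f := P i ^ e i)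
      rw [natDegree_pow, natDegree_eq_one_of_irreducible_complex (hP i), mul_one] at this
      exact this
    have hfd : ∀ i, Module.Finite ℂ (ℂ[X] ⧸ ℂ[X] ∙ P i ^ e i) := fun i =>
      Module.Finite.of_surjective
        ((DirectSum.component ℂ[X] ι _ i).restrictScalars ℂ ∘ₗ e1.toLinearMap)
        (Function.Surjective.comp (g := DirectSum.component ℂ[X] ι _ i)
          (fun a => ⟨DirectSum.lof ℂ[X] ι _ i a, DirectSum.component.lof_self _ _ _⟩)
          e1.surjective)
    rw [e1.finrank_eq, Module.finrank_directSum]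
    simp [hdim]
  · intro W hW hv
    rw [eq_top_iff]
    intro x _
    suffices h : ∀ y, of.symm (Φ.symm y) ∈ W by
      simpa using h (Φ (of x))
    intro y
    induction y using DirectSum.induction_on with
    | zero => simp
    | add a b ha hb => rw [map_add, map_add]; exact add_mem ha hb
    | of i a =>
      obtain ⟨Q, rfl⟩ := Submodule.Quotient.mk_surjective _ a
      have := hmk i Q
      rw [DirectSum.lof_eq_of] at this
      rw [← this, hsmul]
      exact aeval_apply_mem hW Q (hv i)

end JordanExistence

section JordanRank

variable {ι : Type*} [Fintype ι]

/-- The rank of `(T - μ) ^ i` for an operator with Jordan chains of lengths `e j` for `lam j`. -/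
def chainRank (lam : ι → ℂ) (e : ι → ℕ) (μ : ℂ) (i : ℕ) : ℕ :=
  ∑ j, if lam j = μ then e j - i else e j

open Classical in
lemma chainRank_eq_succ_add (lam : ι → ℂ) (e : ι → ℕ) (μ : ℂ) (i : ℕ) :
    chainRank lam e μ i = chainRank lam e μ (i + 1) + #{j | lam j = μ ∧ i < e j} := by
  rw [chainRank, chainRank, Finset.card_filter, ← Finset.sum_add_distrib]
  refine Finset.sum_congr rfl fun j _ => ?_
  by_cases h : lam j = μ
  · simp only [h, if_true, true_and]
    split_ifs <;> omega
  · simp [h]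

open Classical in
lemma card_filter_lt_eq (lam : ι → ℂ) (e : ι → ℕ) (μ : ℂ) (i : ℕ) :
    #{j | lam j = μ ∧ i < e j} =
      #{j | lam j = μ ∧ i + 1 < e j} + #{j | lam j = μ ∧ e j = i + 1} := by
  rw [← Finset.card_union_of_disjoint]
  · congr 1
    ext j
    simp only [Finset.mem_filter, Finset.mem_univ, true_and, Finset.mem_union]
    grind
  · rw [Finset.disjoint_left]
    intro j
    simp only [Finset.mem_filter, Finset.mem_univ, true_and]
    grind

/-- If the ranks are dominated by those of another system, strictly somewhere, then there are two
chains such that moving one box from the shorter to the longer one keeps the domination. -/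
lemma exists_chains_of_chainRank_lt {κ : Type*} [Fintype κ] {lam : ι → ℂ} {e : ι → ℕ}
    {lam' : κ → ℂ} {e' : κ → ℕ} {μ : ℂ} {n i : ℕ} (h0 : ∑ j, e j = ∑ j, e' j)
    (hle : ∀ i, chainRank lam e μ i ≤ chainRank lam' e' μ i)
    (heq : ∀ i, n ≤ i → chainRank lam e μ i = chainRank lam' e' μ i)
    (hlt : chainRank lam e μ i < chainRank lam' e' μ i) :
    ∃ i₀ i₁, i₀ ≠ i₁ ∧ lam i₀ = μ ∧ lam i₁ = μ ∧ 1 ≤ e i₁ ∧ e i₁ ≤ e i₀ ∧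
      ∀ k, e i₁ ≤ k → k ≤ e i₀ → chainRank lam e μ k < chainRank lam' e' μ k := by
  classical
  let r := chainRank lam e μ
  let r' := chainRank lam' e' μ
  have hz : r 0 = r' 0 := by simpa [r, r', chainRank] using h0
  have hP : ∃ P, P < i ∧ r P = r' P ∧ ∀ k, P < k → k ≤ i → r k < r' k := by
    refine ⟨Nat.findGreatest (fun q => r q = r' q) i, ?_, ?_, ?_⟩
    · refine lt_of_le_of_ne (Nat.findGreatest_le i) fun h => ?_
      have := Nat.findGreatest_spec (P := fun q => r q = r' q) (Nat.zero_le i) hz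
      rw [h] at this
      exact hlt.ne this
    · exact Nat.findGreatest_spec (P := fun q => r q = r' q) (Nat.zero_le i) hz
    · intro k hk hki
      exact lt_of_le_of_ne (hle k) (Nat.findGreatest_is_greatest (P := fun q => r q = r' q) hk hki)
  have hQ : ∃ Q, i ≤ Q ∧ r (Q + 1) = r' (Q + 1) ∧ ∀ k, i ≤ k → k ≤ Q → r k < r' k := by
    have hex : ∃ q, r (i + q + 1) = r' (i + q + 1) := ⟨n, heq _ (by omega)⟩
    refine ⟨i + Nat.find hex, by omega, Nat.find_spec hex, ?_⟩
    intro k hk hkq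
    rcases hk.eq_or_lt with rfl | hk
    · exact hlt
    · have := Nat.find_min hex (m := k - i - 1) (by omega)
      rw [show i + (k - i - 1) + 1 = k by omega] at this
      exact lt_of_le_of_ne (hle k) this
  obtain ⟨P, hPi, hPe, hPl⟩ := hP
  obtain ⟨Q, hiQ, hQe, hQl⟩ := hQ
  have hl : ∀ k, P < k → k ≤ Q → r k < r' k := fun k h1 h2 =>
    (le_total k i).elim (hPl k h1) fun h => hQl k h h2
  have c1 := chainRank_eq_succ_add lam e μ P
  have c2 := chainRank_eq_succ_add lam' e' μ P
  have c3 := chainRank_eq_succ_add lam e μ Q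
  have c4 := chainRank_eq_succ_add lam' e' μ Q
  have l1 := hl (P + 1) (by omega) (by omega)
  have l2 := hl Q (by omega) le_rfl
  have c5 : #{j | lam' j = μ ∧ Q < e' j} ≤ #{j | lam' j = μ ∧ P < e' j} :=
    Finset.card_le_card fun j hj => by
      simp only [Finset.mem_filter, Finset.mem_univ, true_and] at hj ⊢
      exact ⟨hj.1, by omega⟩
  have c6 : #{j | lam j = μ ∧ P < e j} =
      #{j | lam j = μ ∧ Q < e j} + #{j | lam j = μ ∧ P < e j ∧ e j ≤ Q} := by
    rw [← Finset.card_union_of_disjoint]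
    · congr 1
      ext j
      simp only [Finset.mem_filter, Finset.mem_univ, true_and, Finset.mem_union]
      grind
    · rw [Finset.disjoint_left]
      intro j
      simp only [Finset.mem_filter, Finset.mem_univ, true_and]
      grind
  have c7 : 1 < #{j | lam j = μ ∧ P < e j ∧ e j ≤ Q} := by
    simp only [r, r'] at *
    omega
  obtain ⟨a, ha, b, hb, hab⟩ := Finset.one_lt_card.1 c7
  simp only [Finset.mem_filter, Finset.mem_univ, true_and] at ha hb
  rcases le_total (e a) (e b) with h | h
  · exact ⟨b, a, hab.symm, hb.1, ha.1, by omega, h, fun k h1 h2 => hl k (by omega) (by omega)⟩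
  · exact ⟨a, b, hab, ha.1, hb.1, by omega, h, fun k h1 h2 => hl k (by omega) (by omega)⟩

lemma chainRank_update [DecidableEq ι] (lam : ι → ℂ) (e : ι → ℕ) {i₀ i₁ : ι} (hne : i₀ ≠ i₁)
    (hlam : lam i₀ = lam i₁) (h1 : 1 ≤ e i₁) (hle : e i₁ ≤ e i₀) (μ : ℂ) (i : ℕ) :
    chainRank lam (Function.update (Function.update e i₀ (e i₀ + 1)) i₁ (e i₁ - 1)) μ i =
      chainRank lam e μ i + if lam i₁ = μ ∧ e i₁ ≤ i ∧ i ≤ e i₀ then 1 else 0 := by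
  have key : ∀ j, (if lam j = μ then
        (Function.update (Function.update e i₀ (e i₀ + 1)) i₁ (e i₁ - 1)) j - i else
        (Function.update (Function.update e i₀ (e i₀ + 1)) i₁ (e i₁ - 1)) j) +
        (if j = i₁ then (if lam i₁ = μ then (if i < e i₁ then 1 else 0) else 1) else 0) =
      (if lam j = μ then e j - i else e j) +
        (if j = i₀ then (if lam i₁ = μ then (if i ≤ e i₀ then 1 else 0) else 1) else 0) := by
    intro j
    by_cases hj1 : j = i₁
    · subst hj1
      rw [Function.update_self]
      simp only [hne.symm, if_true, if_false]
      split_ifs <;> omega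
    · rw [Function.update_of_ne hj1]
      by_cases hj0 : j = i₀
      · subst hj0
        rw [Function.update_self]
        simp only [hne, if_true, if_false, hlam]
        split_ifs <;> omega
      · rw [Function.update_of_ne hj0]
        simp [hj1, hj0]
  have := Finset.sum_congr rfl fun j (_ : j ∈ Finset.univ) => key j
  rw [Finset.sum_add_distrib, Finset.sum_add_distrib, Finset.sum_ite_eq',
    Finset.sum_ite_eq'] at this
  simp only [Finset.mem_univ, if_true] at this
  unfold chainRank
  split_ifs at this ⊢ <;> grind

variable {V : Type*} [AddCommGroup V] [Module ℂ V] {T : Module.End ℂ V} {v : ι → V} {lam : ι → ℂ}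
  {e : ι → ℕ}

namespace IsJordanSystem

/-- Adding a rank one operator that maps the generator of a chain to the generator of another chain
which is at least as long moves a box from the former to the latter. -/
lemma boxMove [DecidableEq ι] (h : IsJordanSystem T v lam e) {i₀ i₁ : ι} (hne : i₀ ≠ i₁)
    (hlam : lam i₀ = lam i₁) (h1 : 1 ≤ e i₁) (hle : e i₁ ≤ e i₀) {η : V →ₗ[ℂ] ℂ}
    (hη : ∀ i q, η (((T - lam i • 1) ^ q) (v i)) = if i = i₁ ∧ q = 0 then 1 else 0)
    {c : ℂ} (hc : c ≠ 0) :
    IsJordanSystem (T + c • η.smulRight (v i₀))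
      (Function.update (Function.update v i₀ (v i₁)) i₁ ((T - lam i₁ • 1) (v i₁))) lam
      (Function.update (Function.update e i₀ (e i₀ + 1)) i₁ (e i₁ - 1)) := by
  set T' := T + c • η.smulRight (v i₀) with hT'
  have hN : ∀ (l : ℂ) w, (T' - l • 1) w = (T - l • 1) w + (c * η w) • v i₀ := by
    intro l w
    simp [hT', mul_smul]
    abel
  have hpow : ∀ i, i ≠ i₁ → ∀ q : ℕ,
      ((T' - lam i • 1) ^ q) (v i) = ((T - lam i • 1) ^ q) (v i) := by
    intro i hi q
    induction q with
    | zero => rfl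
    | succ q ih =>
      rw [pow_succ', Module.End.mul_apply, ih, hN, hη, if_neg (fun h => hi h.1), pow_succ',
        Module.End.mul_apply]
      simp
  have hpow1 : ∀ q : ℕ, ((T' - lam i₁ • 1) ^ q) ((T - lam i₁ • 1) (v i₁)) =
      ((T - lam i₁ • 1) ^ (q + 1)) (v i₁) := by
    intro q
    induction q with
    | zero => simp
    | succ q ih =>
      rw [pow_succ', Module.End.mul_apply, ih, hN, hη, if_neg (fun h => by simp at h),
        pow_succ' _ (q + 1), Module.End.mul_apply]
      simp
  have hy : (T' - lam i₁ • 1) (v i₁) = (T - lam i₁ • 1) (v i₁) + c • v i₀ := by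
    have := hη i₁ 0
    simp only [pow_zero, Module.End.one_apply, and_self, if_true] at this
    rw [hN, this, mul_one]
  refine ⟨?_, ?_, ?_⟩
  · intro i
    by_cases hi1 : i = i₁
    · subst hi1
      rw [Function.update_self, Function.update_self, hpow1, Nat.sub_add_cancel h1]
      exact h.pow_apply i
    · rw [Function.update_of_ne hi1, Function.update_of_ne hi1]
      by_cases hi0 : i = i₀
      · subst hi0
        rw [Function.update_self, Function.update_self, pow_succ, Module.End.mul_apply, hlam, hy,
          map_add, map_smul, hpow1, ← hlam, hpow i hne, h.pow_apply, hlam,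
          h.pow_apply_of_le (by omega)]
        simp
      · rw [Function.update_of_ne hi0, Function.update_of_ne hi0, hpow i hi1, h.pow_apply]
  · have := chainRank_update (ι := ι) (fun _ => (0 : ℂ)) e hne rfl h1 hle 1 0
    simp [chainRank] at this
    rw [← h.sum_eq, ← this]
  · intro W hW hv
    have hv1 := hv i₁
    have hv0 := hv i₀
    rw [Function.update_self] at hv1
    rw [Function.update_of_ne hne, Function.update_self] at hv0
    have hx : v i₀ ∈ W := by
      have : c • v i₀ ∈ W := by
        rw [eq_sub_iff_add_eq'.2 hy.symm]
        refine sub_mem ?_ hv1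
        simpa using sub_mem (hW _ hv0) (W.smul_mem (lam i₁) hv0)
      simpa [smul_smul, hc] using W.smul_mem c⁻¹ this
    refine h.generates W (fun w hw => ?_) (fun i => ?_)
    · have : T w = T' w - (c * η w) • v i₀ := by simp [hT', mul_smul]
      rw [this]
      exact sub_mem (hW w hw) (W.smul_mem _ hx)
    · by_cases hi1 : i = i₁
      · rwa [hi1]
      · by_cases hi0 : i = i₀
        · rwa [hi0]
        · have := hv i
          rwa [Function.update_of_ne hi1, Function.update_of_ne hi0] at this

/-- Discarding the chains of length zero. -/
lemma restrict (h : IsJordanSystem T v lam e) :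
    IsJordanSystem T (fun i : {i // e i ≠ 0} => v i) (fun i => lam i) (fun i => e i) := by
  refine ⟨fun i => h.pow_apply i, ?_, ?_⟩
  · rw [← h.sum_eq, ← Finset.sum_filter_ne_zero (s := Finset.univ) (f := e)]
    exact (Finset.sum_subtype (p := fun i => e i ≠ 0) (Finset.univ.filter fun i => e i ≠ 0)
      (fun i => by simp) e).symm
  · intro W hW hv
    refine h.generates W hW fun i => ?_
    by_cases hi : e i = 0
    · have := h.pow_apply i
      rw [hi, pow_zero, Module.End.one_apply] at this
      rw [this]
      exact zero_mem _
    · exact hv ⟨i, hi⟩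

variable {V' : Type*} [AddCommGroup V'] [Module ℂ V'] {T' : Module.End ℂ V'} {κ : Type*} [Fintype κ]
  {v' : κ → V'} {lam' : κ → ℂ} {e' : κ → ℕ}

/-- Operators with matching Jordan chains are similar. -/
lemma exists_equiv_of_equiv (h : IsJordanSystem T v lam e) (h' : IsJordanSystem T' v' lam' e')
    (σ : ι ≃ κ) (hlam : ∀ i, lam i = lam' (σ i)) (he : ∀ i, e i = e' (σ i)) :
    ∃ φ : V ≃ₗ[ℂ] V', ∀ x, φ (T x) = T' (φ x) := by
  let τ : (Σ i, Fin (e i)) ≃ Σ k, Fin (e' k) := Equiv.sigmaCongr σ fun i => finCongr (he i)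
  let φ := h.basis.equiv h'.basis τ
  have hφ : ∀ (i : ι) (q : ℕ),
      φ (((T - lam i • 1) ^ q) (v i)) = ((T' - lam i • 1) ^ q) (v' (σ i)) := by
    intro i q
    by_cases hq : q < e i
    · have h1 := h.basis.equiv_apply ⟨i, q, hq⟩ h'.basis τ
      rw [h.basis_apply, h'.basis_apply] at h1
      refine h1.trans ?_
      rw [hlam]
      rfl
    · rw [h.pow_apply_of_le (not_lt.1 hq), map_zero, hlam,
        h'.pow_apply_of_le (by rw [← he]; exact not_lt.1 hq)]
  refine ⟨φ, fun x => ?_⟩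
  have : φ.toLinearMap ∘ₗ T = T' ∘ₗ φ.toLinearMap := by
    refine h.basis.ext fun p => ?_
    rw [h.basis_apply]
    simp only [LinearMap.comp_apply, LinearEquiv.coe_coe]
    rw [hφ, apply_pow, apply_pow, map_add, map_smul, hφ, hφ]
  exact LinearMap.congr_fun this x

lemma exists_equiv_of_chainRank_eq (h : IsJordanSystem T v lam e)
    (h' : IsJordanSystem T' v' lam' e') (he : ∀ i, e i ≠ 0) (he' : ∀ i, e' i ≠ 0)
    (heq : ∀ μ i, chainRank lam e μ i = chainRank lam' e' μ i) :
    ∃ φ : V ≃ₗ[ℂ] V', ∀ x, φ (T x) = T' (φ x) := by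
  classical
  have hcount : ∀ μ i, #{j | lam j = μ ∧ i < e j} = #{j | lam' j = μ ∧ i < e' j} := by
    intro μ i
    have h1 := chainRank_eq_succ_add lam e μ i
    have h2 := chainRank_eq_succ_add lam' e' μ i
    rw [heq, heq] at h1
    omega
  have hfib : ∀ a : ℂ × ℕ, #{j | (lam j, e j) = a} = #{j | (lam' j, e' j) = a} := by
    rintro ⟨μ, k⟩
    cases k with
    | zero =>
      rw [Finset.filter_false_of_mem (by simp [he]), Finset.filter_false_of_mem (by simp [he'])]
      simp
    | succ i =>
      have h1 := card_filter_lt_eq lam e μ i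
      have h2 := card_filter_lt_eq lam' e' μ i
      rw [hcount, hcount] at h1
      simp only [Prod.mk.injEq]
      omega
  let σ' : ∀ a : ℂ × ℕ, {j // (lam j, e j) = a} ≃ {j // (lam' j, e' j) = a} := fun a =>
    Fintype.equivOfCardEq (by rw [Fintype.card_subtype, Fintype.card_subtype, hfib])
  let σ : ι ≃ κ := (Equiv.sigmaFiberEquiv fun j => (lam j, e j)).symm.trans
    ((Equiv.sigmaCongrRight σ').trans (Equiv.sigmaFiberEquiv fun j => (lam' j, e' j)))
  have hσ : ∀ j, (lam' (σ j), e' (σ j)) = (lam j, e j) := fun j =>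
    (σ' (lam j, e j) ⟨j, rfl⟩).2
  exact h.exists_equiv_of_equiv h' σ (fun j => (congrArg Prod.fst (hσ j)).symm)
    fun j => (congrArg Prod.snd (hσ j)).symm

end IsJordanSystem

/-- Operators such that all powers of all their translates have the same rank are similar. -/
theorem exists_equiv_of_finrank_range_eq {V V' : Type*} [AddCommGroup V] [Module ℂ V]
    [FiniteDimensional ℂ V] [AddCommGroup V'] [Module ℂ V'] [FiniteDimensional ℂ V']
    (T : Module.End ℂ V) (T' : Module.End ℂ V')
    (heq : ∀ (μ : ℂ) (i : ℕ), Module.finrank ℂ (LinearMap.range ((T - μ • 1) ^ i)) =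
      Module.finrank ℂ (LinearMap.range ((T' - μ • 1) ^ i))) :
    ∃ φ : V ≃ₗ[ℂ] V', ∀ x, φ (T x) = T' (φ x) := by
  obtain ⟨ι, _, v, lam, e, h⟩ := exists_isJordanSystem T
  obtain ⟨κ, _, v', lam', e', h'⟩ := exists_isJordanSystem T'
  refine h.restrict.exists_equiv_of_chainRank_eq h'.restrict (fun i => i.2) (fun i => i.2) ?_
  intro μ i
  have := heq μ i
  rwa [h.restrict.finrank_range, h'.restrict.finrank_range] at this

end JordanRank

section MatrixRank

variable {N : Type*} [Fintype N] [DecidableEq N]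

/-- The rank of `(M - μ) ^ i`. -/
def powRank (M : Matrix N N ℂ) (μ : ℂ) (i : ℕ) : ℕ := ((M - μ • 1) ^ i).rank

lemma powRank_eq_finrank_range (M : Matrix N N ℂ) (μ : ℂ) (i : ℕ) :
    powRank M μ i = Module.finrank ℂ (LinearMap.range ((Matrix.toLin' M - μ • 1) ^ i)) := by
  have : (Matrix.toLin' M - μ • 1) ^ i = Matrix.toLin' ((M - μ • 1) ^ i) := by
    rw [Matrix.toLin'_pow, map_sub, map_smul, Matrix.toLin'_one]
    rfl
  rw [this, powRank, Matrix.rank_eq_finrank_range_toLin _ (Pi.basisFun ℂ N) (Pi.basisFun ℂ N)]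
  rfl

lemma powRank_units_conj (g : (Matrix N N ℂ)ˣ) (M : Matrix N N ℂ) (μ : ℂ) (i : ℕ) :
    powRank ((g : Matrix N N ℂ) * M * (↑g⁻¹ : Matrix N N ℂ)) μ i = powRank M μ i := by
  have h1 : (g : Matrix N N ℂ) * M * (↑g⁻¹ : Matrix N N ℂ) - μ • 1 =
      (g : Matrix N N ℂ) * (M - μ • 1) * (↑g⁻¹ : Matrix N N ℂ) := by
    rw [mul_sub, sub_mul, mul_smul_comm, mul_one, smul_mul_assoc, Units.mul_inv]
  rw [powRank, h1, Units.conj_pow, Matrix.rank_mul_eq_left_of_isUnit_det,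
    Matrix.rank_mul_eq_right_of_isUnit_det, powRank]
  · exact (Matrix.isUnit_iff_isUnit_det _).1 g.isUnit
  · exact (Matrix.isUnit_iff_isUnit_det _).1 g⁻¹.isUnit

/-- Matrices such that all powers of all their translates have the same rank are conjugate. -/
lemma exists_units_conj_of_powRank_eq {M M' : Matrix N N ℂ}
    (heq : ∀ μ i, powRank M μ i = powRank M' μ i) :
    ∃ g : (Matrix N N ℂ)ˣ, M' = (g : Matrix N N ℂ) * M * (↑g⁻¹ : Matrix N N ℂ) := by
  obtain ⟨φ, hφ⟩ := exists_equiv_of_finrank_range_eq (Matrix.toLin' M) (Matrix.toLin' M')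
    fun μ i => by rw [← powRank_eq_finrank_range, ← powRank_eq_finrank_range, heq]
  let g : (Matrix N N ℂ)ˣ :=
    ⟨LinearMap.toMatrix' φ.toLinearMap, LinearMap.toMatrix' φ.symm.toLinearMap,
      by rw [← LinearMap.toMatrix'_comp]; simp, by rw [← LinearMap.toMatrix'_comp]; simp⟩
  refine ⟨g, ?_⟩
  rw [Units.eq_mul_inv_iff_mul_eq]
  apply Matrix.toLin'.injective
  change Matrix.toLin' (M' * LinearMap.toMatrix' φ.toLinearMap) =
    Matrix.toLin' (LinearMap.toMatrix' φ.toLinearMap * M)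
  rw [Matrix.toLin'_mul, Matrix.toLin'_mul, Matrix.toLin'_toMatrix']
  ext1 x
  ext1
  simp only [LinearMap.comp_apply, LinearEquiv.coe_coe, hφ]

variable {K : Type} [Fintype K] [DecidableEq K]

/-- Extension by zero from a block. -/
def blockIncl (c : N → K) (k : K) : ({i // c i = k} → ℂ) →ₗ[ℂ] (N → ℂ) where
  toFun u i := if h : c i = k then u ⟨i, h⟩ else 0
  map_add' u w := by ext i; by_cases h : c i = k <;> simp [h]
  map_smul' a u := by ext i; by_cases h : c i = k <;> simp [h]

omit [DecidableEq N] [Fintype K] [Fintype N] in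
lemma blockIncl_apply_of_ne {c : N → K} {k : K} (u : {i // c i = k} → ℂ) {i : N} (h : c i ≠ k) :
    blockIncl c k u i = 0 := by
  simp [blockIncl, h]

omit [Fintype K] in
lemma toLin'_blockIncl {c : N → K} {M : Matrix N N ℂ} (hM : ∀ i i', c i ≠ c i' → M i i' = 0) (k : K)
    (u : {i // c i = k} → ℂ) :
    Matrix.toLin' M (blockIncl c k u) =
      blockIncl c k (Matrix.toLin' (M.submatrix Subtype.val Subtype.val) u) := by
  ext i
  rw [Matrix.toLin'_apply, Matrix.mulVec, dotProduct]
  by_cases hi : c i = k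
  · simp only [blockIncl, LinearMap.coe_mk, AddHom.coe_mk, hi, dif_pos, Matrix.toLin'_apply,
      Matrix.mulVec, dotProduct, Matrix.submatrix_apply]
    rw [← Finset.sum_filter_add_sum_filter_not Finset.univ (fun j => c j = k)]
    rw [Finset.sum_eq_zero (s := Finset.univ.filter fun j => ¬ c j = k), add_zero,
      Finset.sum_subtype (p := fun j => c j = k) (Finset.univ.filter fun j => c j = k) (by simp)]
    · refine Finset.sum_congr rfl fun j _ => ?_
      simp [j.2]
    · intro j hj
      simp [(Finset.mem_filter.1 hj).2]
  · rw [blockIncl_apply_of_ne _ hi]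
    refine Finset.sum_eq_zero fun j _ => ?_
    by_cases hj : c j = k
    · rw [hM i j (fun h => hi (h.trans hj)), zero_mul]
    · rw [blockIncl_apply_of_ne _ hj, mul_zero]

omit [Fintype K] in
lemma pow_toLin'_blockIncl {c : N → K} {M : Matrix N N ℂ} (hM : ∀ i i', c i ≠ c i' → M i i' = 0)
    (k : K) (l : ℂ) (q : ℕ) (u : {i // c i = k} → ℂ) :
    ((Matrix.toLin' M - l • 1) ^ q) (blockIncl c k u) =
      blockIncl c k (((Matrix.toLin' (M.submatrix Subtype.val Subtype.val) - l • 1 :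
        Module.End ℂ ({i // c i = k} → ℂ)) ^ q) u) := by
  induction q with
  | zero => rfl
  | succ q ih =>
    rw [pow_succ', Module.End.mul_apply, ih, pow_succ', Module.End.mul_apply]
    simp only [LinearMap.sub_apply, toLin'_blockIncl hM, map_sub, LinearMap.smul_apply,
      Module.End.one_apply, map_smul]

/-- A block diagonal matrix has a Jordan system whose chains lie in the blocks. -/
lemma exists_isJordanSystem_of_blocks {c : N → K} {M : Matrix N N ℂ}
    (hM : ∀ i i', c i ≠ c i' → M i i' = 0) :
    ∃ (ι : Type) (_ : Fintype ι) (v : ι → N → ℂ) (lam : ι → ℂ) (e : ι → ℕ) (b : ι → K),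
      IsJordanSystem (Matrix.toLin' M) v lam e ∧
      ∀ (j : ι) (q : ℕ) (i : N), c i ≠ b j →
        ((Matrix.toLin' M - lam j • 1) ^ q) (v j) i = 0 := by
  choose ι hι v lam e h using fun k : K =>
    exists_isJordanSystem (Matrix.toLin' (M.submatrix (Subtype.val : {i // c i = k} → N)
      (Subtype.val : {i // c i = k} → N)))
  refine ⟨Σ k, ι k, inferInstance, fun p => blockIncl c p.1 (v p.1 p.2), fun p => lam p.1 p.2,
    fun p => e p.1 p.2, fun p => p.1, ⟨?_, ?_, ?_⟩, ?_⟩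
  · rintro ⟨k, j⟩
    dsimp only
    rw [pow_toLin'_blockIncl hM, (h k).pow_apply, map_zero]
  · rw [Fintype.sum_sigma]
    simp only [(h _).sum_eq, Module.finrank_fintype_fun_eq_card]
    rw [← Fintype.card_sigma, Fintype.card_congr (Equiv.sigmaFiberEquiv c)]
  · intro W hW hv
    have hmem : ∀ k u, blockIncl c k u ∈ W := by
      intro k u
      have := (h k).generates (W.comap (blockIncl c k)) (fun w hw => ?_) (fun j => hv ⟨k, j⟩)
      · rw [← Submodule.mem_comap, this]
        trivial
      · rw [Submodule.mem_comap, ← toLin'_blockIncl hM]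
        exact hW _ hw
    rw [eq_top_iff]
    intro w _
    have : w = ∑ k, blockIncl c k (fun i => w i) := by
      ext i
      simp [blockIncl]
    rw [this]
    exact sum_mem fun k _ => hmem k _
  · rintro ⟨k, j⟩ q i hi
    simp only at hi ⊢
    rw [pow_toLin'_blockIncl hM, blockIncl_apply_of_ne _ hi]

/-- If the ranks of a block diagonal matrix `M` are dominated by those of `A`, strictly somewhere,
then a rank one perturbation mapping one block to another increases the ranks of `M`, and keeps
them dominated by those of `A`. -/
lemma exists_vecMulVec_powRank {c : N → K} {M A : Matrix N N ℂ}
    (hM : ∀ i i', c i ≠ c i' → M i i' = 0) (hle : ∀ μ i, powRank M μ i ≤ powRank A μ i)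
    (heq : ∀ μ i, Fintype.card N ≤ i → powRank M μ i = powRank A μ i)
    (hlt : ∃ μ i, powRank M μ i < powRank A μ i) :
    ∃ (x η : N → ℂ) (k l : K), (∀ i, c i ≠ k → x i = 0) ∧ (∀ i, c i ≠ l → η i = 0) ∧
      η ⬝ᵥ x = 0 ∧ ∀ ε : ℂ, ε ≠ 0 →
        (∀ μ i, powRank M μ i ≤ powRank (M + ε • Matrix.vecMulVec x η) μ i) ∧
        (∀ μ i, powRank (M + ε • Matrix.vecMulVec x η) μ i ≤ powRank A μ i) ∧
        ∃ μ i, powRank M μ i < powRank (M + ε • Matrix.vecMulVec x η) μ i := by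
  classical
  obtain ⟨ι, _, v, lam, e, b, h, hb⟩ := exists_isJordanSystem_of_blocks hM
  obtain ⟨κ, _, v', lam', e', h'⟩ := exists_isJordanSystem (Matrix.toLin' A)
  have hrM : ∀ μ i, powRank M μ i = chainRank lam e μ i := fun μ i => by
    rw [powRank_eq_finrank_range, h.finrank_range, chainRank]
  have hrA : ∀ μ i, powRank A μ i = chainRank lam' e' μ i := fun μ i => by
    rw [powRank_eq_finrank_range, h'.finrank_range, chainRank]
  obtain ⟨μ, i, hlt⟩ := hlt
  rw [hrM, hrA] at hlt
  obtain ⟨i₀, i₁, hne, hl0, hl1, h1, h10, hk⟩ := exists_chains_of_chainRank_lt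
    (n := Fintype.card N) (h.sum_eq.trans h'.sum_eq.symm)
    (fun i => by rw [← hrM, ← hrA]; exact hle μ i)
    (fun i hi => by rw [← hrM, ← hrA]; exact heq μ i hi) hlt
  let P : (N → ℂ) →ₗ[ℂ] (N → ℂ) :=
    Matrix.toLin' (Matrix.diagonal fun i => if c i = b i₁ then 1 else 0)
  have hP : ∀ w i, P w i = if c i = b i₁ then w i else 0 := by
    intro w i
    simp [P, Matrix.mulVec_diagonal]
  let φ : (N → ℂ) →ₗ[ℂ] ℂ := h.basis.coord ⟨i₁, 0, h1⟩ ∘ₗ P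
  have hφ : ∀ (i : ι) (q : ℕ), φ (((Matrix.toLin' M - lam i • 1) ^ q) (v i)) =
      if i = i₁ ∧ q = 0 then 1 else 0 := by
    intro i q
    by_cases hbi : b i = b i₁
    · have hPv : P (((Matrix.toLin' M - lam i • 1) ^ q) (v i)) =
          ((Matrix.toLin' M - lam i • 1) ^ q) (v i) := by
        ext j
        rw [hP]
        split_ifs with hj
        · rfl
        · exact (hb i q j (fun h => hj (h.trans hbi))).symm
      simp only [φ, LinearMap.comp_apply, hPv]
      by_cases hq : q < e i
      · have hbas := h.basis_apply ⟨i, q, hq⟩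
        simp only at hbas
        rw [← hbas, Module.Basis.coord_apply, Module.Basis.repr_self, Finsupp.single_apply]
        by_cases hi : i = i₁
        · subst hi
          simp [Fin.ext_iff]
        · simp [hi]
      · rw [h.pow_apply_of_le (not_lt.1 hq), map_zero, if_neg]
        rintro ⟨rfl, rfl⟩
        exact hq h1
    · have hPv : P (((Matrix.toLin' M - lam i • 1) ^ q) (v i)) = 0 := by
        ext j
        rw [hP]
        split_ifs with hj
        · exact hb i q j (fun h => hbi (h.symm.trans hj))
        · rfl
      simp only [φ, LinearMap.comp_apply, hPv, map_zero]
      rw [if_neg]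
      rintro ⟨rfl, -⟩
      exact hbi rfl
  have hφs : ∀ w, (fun i => φ (Pi.single i 1)) ⬝ᵥ w = φ w := by
    intro w
    conv_rhs => rw [← Finset.univ_sum_single w]
    rw [map_sum, dotProduct]
    refine Finset.sum_congr rfl fun i _ => ?_
    have : (Pi.single i (w i) : N → ℂ) = w i • Pi.single i 1 := by
      rw [← Pi.single_smul]; simp
    rw [this, map_smul, smul_eq_mul, mul_comm]
  refine ⟨v i₀, fun i => φ (Pi.single i 1), b i₀, b i₁, fun i hi => ?_, fun i hi => ?_, ?_, ?_⟩
  · simpa using hb i₀ 0 i hi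
  · have : P (Pi.single i 1) = 0 := by
      ext j
      rw [hP]
      split_ifs with hj
      · rw [Pi.single_eq_of_ne, Pi.zero_apply]
        rintro rfl
        exact hi hj
      · rfl
    simp [φ, this]
  · rw [hφs]
    simpa [hne] using hφ i₀ 0
  · intro ε hε
    have hl : lam i₀ = lam i₁ := hl0.trans hl1.symm
    have hbox := h.boxMove hne hl h1 h10 hφ hε
    have hT : Matrix.toLin' (M + ε • Matrix.vecMulVec (v i₀) fun i => φ (Pi.single i 1)) =
        Matrix.toLin' M + ε • φ.smulRight (v i₀) := by
      rw [map_add, map_smul]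
      congr 2
      refine LinearMap.ext fun w => ?_
      rw [Matrix.toLin'_apply, Matrix.vecMulVec_mulVec, hφs]
      ext i
      simp [mul_comm]
    have hr : ∀ ν i, powRank (M + ε • Matrix.vecMulVec (v i₀) fun i => φ (Pi.single i 1)) ν i =
        chainRank lam e ν i + if lam i₁ = ν ∧ e i₁ ≤ i ∧ i ≤ e i₀ then 1 else 0 := by
      intro ν i
      rw [powRank_eq_finrank_range, hT, hbox.finrank_range, ← chainRank_update lam e hne hl h1 h10,
        chainRank]
    refine ⟨fun ν i => ?_, fun ν i => ?_, μ, e i₁, ?_⟩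
    · rw [hrM, hr]
      exact Nat.le_add_right _ _
    · rw [hr, hrA]
      split_ifs with hc
      · rw [← hc.1, hl1]
        exact hk i hc.2.1 hc.2.2
      · rw [add_zero, ← hrM, ← hrA]
        exact hle ν i
    · rw [hrM, hr, if_pos ⟨hl1, le_rfl, h10⟩]
      exact Nat.lt_succ_self _

end MatrixRank

section Block

variable {N : Type*} [Fintype N] [DecidableEq N] {K : Type*} [DecidableEq K]

/-- The block diagonal part of a matrix. -/
def blockProj (c : N → K) : Matrix N N ℂ →ₗ[ℂ] Matrix N N ℂ where
  toFun M := Matrix.of fun i i' => if c i = c i' then M i i' else 0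
  map_add' M M' := by ext i i'; by_cases h : c i = c i' <;> simp [h]
  map_smul' a M := by ext i i'; by_cases h : c i = c i' <;> simp [h]

omit [Fintype N] [DecidableEq N] in
lemma blockProj_apply (c : N → K) (M : Matrix N N ℂ) (i i' : N) :
    blockProj c M i i' = if c i = c i' then M i i' else 0 := rfl

omit [DecidableEq K] in
lemma block_iff_commute {c : N → K} {M : Matrix N N ℂ} :
    (∀ i i', c i ≠ c i' → M i i' = 0) ↔
      ∀ z : K → ℂ, Commute M (Matrix.diagonal fun i => z (c i)) := by
  classical
  constructor
  · intro h z
    ext i i'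
    rw [Matrix.mul_diagonal, Matrix.diagonal_mul]
    by_cases hc : c i = c i'
    · rw [hc, mul_comm]
    · rw [h i i' hc, zero_mul, mul_zero]
  · intro h i i' hc
    have := congrFun (congrFun (h (Pi.single (c i) 1)) i) i'
    rw [Matrix.mul_diagonal, Matrix.diagonal_mul] at this
    simpa [Pi.single_eq_of_ne (Ne.symm hc)] using this.symm

lemma commute_blockProj (c : N → K) (M : Matrix N N ℂ) (z : K → ℂ) :
    Commute (blockProj c M) (Matrix.diagonal fun i => z (c i)) :=
  block_iff_commute.1 (fun i i' h => by rw [blockProj_apply, if_neg h]) z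

/-- A block diagonal matrix which is a sum of a matrix vanishing on the diagonal blocks and a
matrix which is scalar on each block vanishes, if all its blocks have trace zero. -/
lemma eq_zero_of_add_offBlock_add_diagonal {c : N → K} {P W : Matrix N N ℂ} {u : K → ℂ}
    (hP : ∀ z : K → ℂ, Commute P (Matrix.diagonal fun i => z (c i)))
    (htr : ∀ z : K → ℂ, (P * Matrix.diagonal fun i => z (c i)).trace = 0)
    (h : P + (W - blockProj c W) + Matrix.diagonal (fun i => u (c i)) = 0) : P = 0 := by
  rw [← block_iff_commute] at hP
  have hPd : P = -Matrix.diagonal (fun i => u (c i)) := by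
    ext i i'
    have h' := congrFun (congrFun h i) i'
    simp only [Matrix.add_apply, Matrix.sub_apply, blockProj_apply, Matrix.zero_apply] at h'
    rw [Matrix.neg_apply]
    by_cases hc : c i = c i'
    · rw [if_pos hc, sub_self, add_zero] at h'
      exact eq_neg_of_add_eq_zero_left h'
    · rw [hP i i' hc, Matrix.diagonal_apply_ne _ fun hi => hc (congrArg c hi), neg_zero]
  have h0 := htr fun k => (starRingEnd ℂ) (u k)
  rw [hPd, neg_mul, Matrix.diagonal_mul_diagonal, Matrix.trace_neg, Matrix.trace_diagonal,
    neg_eq_zero] at h0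
  have hu : ∀ i, u (c i) = 0 := by
    simp only [Complex.mul_conj] at h0
    rw [← Complex.ofReal_sum, Complex.ofReal_eq_zero,
      Finset.sum_eq_zero_iff_of_nonneg fun _ _ => Complex.normSq_nonneg _] at h0
    exact fun i => Complex.normSq_eq_zero.1 (h0 i (Finset.mem_univ i))
  rw [hPd]
  simp [hu]

variable {J : Type*} [Fintype J] [DecidableEq J]

omit [DecidableEq J] in
/-- The infinitesimal conjugations of a tuple of block diagonal matrices with connected blocks
span all block diagonal matrices up to matrices which are scalar on each block. -/
lemma exists_sum_commutator_add {c : N → K} {B : J → Matrix N N ℂ} {s : J} {d : N → ℂ}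
    (hB : ∀ j i i', c i ≠ c i' → B j i i' = 0)
    (hconn : ∀ f : N → ℂ, (∀ j i i', B j i i' ≠ 0 → f i = f i') →
      ∃ g : K → ℂ, ∀ i, f i = g (c i))
    (hs : B s = Matrix.diagonal d) (hd : Function.Injective d) (Y : Matrix N N ℂ) :
    ∃ (X : J → Matrix N N ℂ) (W : Matrix N N ℂ) (u : K → ℂ),
      ∑ j, (blockProj c (X j) * B j - B j * blockProj c (X j)) + (W - blockProj c W) +
        Matrix.diagonal (fun i => u (c i)) = Y := by
  classical
  let L : ((J → Matrix N N ℂ) × Matrix N N ℂ × (K → ℂ)) →ₗ[ℂ] Matrix N N ℂ :=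
    { toFun := fun p => ∑ j, (blockProj c (p.1 j) * B j - B j * blockProj c (p.1 j)) +
        (p.2.1 - blockProj c p.2.1) + Matrix.diagonal (fun i => p.2.2 (c i))
      map_add' := fun p q => by
        have : Matrix.diagonal (fun i => (p + q).2.2 (c i)) =
            Matrix.diagonal (fun i => p.2.2 (c i)) + Matrix.diagonal (fun i => q.2.2 (c i)) := by
          rw [Matrix.diagonal_add]; rfl
        rw [this]
        simp only [Prod.fst_add, Prod.snd_add, Pi.add_apply, map_add, add_mul, mul_add,
          Finset.sum_sub_distrib, Finset.sum_add_distrib]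
        abel
      map_smul' := fun a p => by
        have : Matrix.diagonal (fun i => (a • p).2.2 (c i)) =
            a • Matrix.diagonal (fun i => p.2.2 (c i)) := by
          rw [← Matrix.diagonal_smul]; rfl
        rw [this]
        simp only [Prod.smul_fst, Prod.smul_snd, Pi.smul_apply, map_smul, smul_mul_assoc,
          mul_smul_comm, ← smul_sub, ← Finset.smul_sum, ← smul_add, RingHom.id_apply] }
  suffices hL : LinearMap.range L = ⊤ by
    obtain ⟨⟨X, W, u⟩, h⟩ := LinearMap.range_eq_top.1 hL Y
    exact ⟨X, W, u, h⟩
  by_contra hL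
  obtain ⟨f, hf0, hf⟩ := Submodule.exists_le_ker_of_lt_top _ (lt_top_iff_ne_top.2 hL)
  have hfL : ∀ X W u, f (L (X, W, u)) = 0 := fun X W u => hf ⟨_, rfl⟩
  let G : Matrix N N ℂ := Matrix.of fun i i' => f (Matrix.single i' i 1)
  have hfG : ∀ M, f M = (G * M).trace := by
    intro M
    conv_lhs => rw [Matrix.matrix_eq_sum_single M]
    simp only [map_sum, Matrix.trace, Matrix.diag_apply, Matrix.mul_apply, G, Matrix.of_apply]
    rw [Finset.sum_comm]
    refine Finset.sum_congr rfl fun i _ => Finset.sum_congr rfl fun i' _ => ?_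
    rw [← mul_one (M i' i), ← smul_eq_mul, ← Matrix.smul_single, map_smul, smul_eq_mul,
      smul_eq_mul, mul_one, mul_comm]
  have hGb : ∀ i i', c i ≠ c i' → G i i' = 0 := by
    intro i i' hc
    have h := hfL 0 (Matrix.single i' i 1) 0
    have h0 : blockProj c (Matrix.single i' i (1 : ℂ)) = 0 := by
      ext a b
      rw [blockProj_apply, Matrix.single_apply]
      split_ifs with h1 h2
      · exact absurd (h2.1 ▸ h2.2 ▸ h1.symm) hc
      · rfl
      · rfl
    simpa [L, h0, G] using h
  have hGc : ∀ j, G * B j = B j * G := by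
    intro j
    ext i i'
    by_cases hc : c i = c i'
    · have h := hfL (Pi.single j (Matrix.single i' i 1)) 0 0
      have h0 : blockProj c (Matrix.single i' i (1 : ℂ)) = Matrix.single i' i 1 := by
        ext a b
        rw [blockProj_apply, Matrix.single_apply]
        split_ifs with h1 h2 h2
        · rfl
        · rfl
        · exact absurd (h2.1 ▸ h2.2 ▸ hc.symm) h1
        · rfl
      have hsum : ∑ j', (blockProj c ((Pi.single j (Matrix.single i' i (1 : ℂ)) :
          J → Matrix N N ℂ) j') * B j' - B j' * blockProj c ((Pi.single j
            (Matrix.single i' i (1 : ℂ)) : J → Matrix N N ℂ) j')) =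
          Matrix.single i' i 1 * B j - B j * Matrix.single i' i 1 := by
        rw [Finset.sum_eq_single j, Pi.single_eq_same, h0]
        · intro j' _ hj
          rw [Pi.single_eq_of_ne hj]; simp
        · intro h; exact absurd (Finset.mem_univ j) h
      have hLX : L (Pi.single j (Matrix.single i' i 1), 0, 0) =
          Matrix.single i' i 1 * B j - B j * Matrix.single i' i 1 := by
        rw [← hsum]
        simp [L]
      rw [hLX, hfG, mul_sub, Matrix.trace_sub, ← mul_assoc, ← mul_assoc, Matrix.trace_mul_comm,
        ← mul_assoc, Matrix.trace_mul_single, Matrix.trace_mul_single, sub_eq_zero] at h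
      simpa using h.symm
    · have h1 := block_iff_commute.1 hGb
      have h2 := block_iff_commute.1 (hB j)
      rw [block_iff_commute.2 (fun z => (h1 z).mul_left (h2 z)) i i' hc,
        block_iff_commute.2 (fun z => (h2 z).mul_left (h1 z)) i i' hc]
  have hGd : ∀ i i', i ≠ i' → G i i' = 0 := by
    intro i i' hi
    have h := congrFun (congrFun (hGc s) i) i'
    rw [hs, Matrix.mul_diagonal, Matrix.diagonal_mul] at h
    have h' : (d i' - d i) * G i i' = 0 := by linear_combination h
    exact (mul_eq_zero.1 h').resolve_left (sub_ne_zero.2 fun h => hi (hd h).symm)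
  have hGD : G = Matrix.diagonal fun i => G i i := by
    ext i i'
    by_cases hi : i = i'
    · subst hi; simp
    · rw [hGd i i' hi, Matrix.diagonal_apply_ne _ hi]
  obtain ⟨g, hg⟩ := hconn (fun i => G i i) fun j i i' hne => by
    have h := congrFun (congrFun (hGc j) i) i'
    rw [hGD, Matrix.mul_diagonal, Matrix.diagonal_mul, mul_comm] at h
    exact mul_left_cancel₀ hne h
  have h := hfL 0 0 fun k => (starRingEnd ℂ) (g k)
  have hLu : L (0, 0, fun k => (starRingEnd ℂ) (g k)) =
      Matrix.diagonal fun i => (starRingEnd ℂ) (g (c i)) := by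
    simp [L]
  rw [hLu, hfG, hGD, Matrix.diagonal_mul_diagonal, Matrix.trace_diagonal] at h
  simp only [hg, Complex.mul_conj] at h
  rw [← Complex.ofReal_sum, Complex.ofReal_eq_zero,
    Finset.sum_eq_zero_iff_of_nonneg fun _ _ => Complex.normSq_nonneg _] at h
  have hG0 : G = 0 := by
    rw [hGD, Matrix.diagonal_eq_zero]
    ext i
    simp only [hg]
    exact Complex.normSq_eq_zero.1 (h i (Finset.mem_univ i))
  apply hf0
  ext M
  rw [hfG, hG0, zero_mul, Matrix.trace_zero]
  rfl

end Block

section Deformation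

open Topology

variable {N : Type*} [Fintype N] [DecidableEq N] {K : Type*} [Fintype K] [DecidableEq K]
  {J : Type*} [Fintype J] [DecidableEq J]

/-- The derivative of a conjugation by exponentials. -/
lemma exists_hasStrictFDerivAt_exp_conj {V 𝔸 : Type*} [NormedAddCommGroup V] [NormedSpace ℂ V]
    [NormedRing 𝔸] [NormedAlgebra ℂ 𝔸] [CompleteSpace 𝔸] (a b : V →L[ℂ] 𝔸) (C : 𝔸) :
    ∃ f' : V →L[ℂ] 𝔸, HasStrictFDerivAt
        (fun p => NormedSpace.exp (a p) * (C + b p) * NormedSpace.exp (-a p)) f' 0 ∧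
      ∀ p, f' p = a p * C + b p - C * a p := by
  have hexp : ∀ a : V →L[ℂ] 𝔸, HasStrictFDerivAt (fun p => NormedSpace.exp (a p)) a 0 := by
    intro a
    have h : HasStrictFDerivAt NormedSpace.exp (1 : 𝔸 →L[ℂ] 𝔸) (a 0) := by
      rw [map_zero]; exact hasStrictFDerivAt_exp_zero
    exact h.comp (0 : V) a.hasStrictFDerivAt
  refine ⟨_, ((hexp a).mul' (b.hasStrictFDerivAt.const_add C)).mul' (hexp (-a)), fun p => ?_⟩
  simp
  abel

lemma exp_mul_exp_neg {𝔸 : Type*} [NormedRing 𝔸] [NormedAlgebra ℂ 𝔸] [CompleteSpace 𝔸] (a : 𝔸) :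
    NormedSpace.exp a * NormedSpace.exp (-a) = 1 := by
  have : NormedAlgebra ℚ 𝔸 := NormedAlgebra.restrictScalars ℚ ℂ 𝔸
  rw [← NormedSpace.exp_add_of_commute (Commute.refl a).neg_right, add_neg_cancel,
    NormedSpace.exp_zero]

/-- The space of parameters of the deformations. -/
abbrev DeformationParam (J N K : Type*) :=
  (J → Matrix N N ℂ) × Matrix N N ℂ × (K → ℂ) × ℂ

open scoped Matrix.Norms.Operator in
lemma exists_deformation_of_commute {c : N → K} {B : J → Matrix N N ℂ} {s : J} {d : N → ℂ}
    (hB : ∀ j i i', c i ≠ c i' → B j i i' = 0)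
    (hconn : ∀ f : N → ℂ, (∀ j i i', B j i i' ≠ 0 → f i = f i') →
      ∃ g : K → ℂ, ∀ i, f i = g (c i))
    (hs : B s = Matrix.diagonal d) (hd : Function.Injective d) (hsum : ∑ j, B j = 0)
    {E : Matrix N N ℂ} (hE : ∀ z : K → ℂ, Commute E (Matrix.diagonal fun i => z (c i)))
    (hEtr : ∀ z : K → ℂ, (E * Matrix.diagonal fun i => z (c i)).trace = 0) (j₀ : J)
    {U : Set (J → Matrix N N ℂ)} (hU : U ∈ 𝓝 B) :
    ∃ ε : ℂ, ε ≠ 0 ∧ ∃ B' ∈ U, ∑ j, B' j = 0 ∧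
      ∀ j, ∃ g : (Matrix N N ℂ)ˣ, B' j = (g : Matrix N N ℂ) *
        (B j + ε • (Pi.single j₀ E : J → Matrix N N ℂ) j) * (↑g⁻¹ : Matrix N N ℂ) := by
  obtain ⟨π, hπ⟩ : ∃ π : Matrix N N ℂ →L[ℂ] Matrix N N ℂ, ∀ X, π X = blockProj c X :=
    ⟨LinearMap.toContinuousLinearMap (blockProj c), fun _ => rfl⟩
  obtain ⟨Δ, hΔ⟩ : ∃ Δ : (K → ℂ) →L[ℂ] Matrix N N ℂ,
      ∀ u, Δ u = Matrix.diagonal fun i => u (c i) :=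
    ⟨LinearMap.toContinuousLinearMap
      (Matrix.diagonalLinearMap N ℂ ℂ ∘ₗ LinearMap.funLeft ℂ ℂ c), fun _ => rfl⟩
  let β : DeformationParam J N K → J → Matrix N N ℂ := fun p j => NormedSpace.exp (π (p.1 j)) *
    (B j + p.2.2.2 • (Pi.single j₀ E : J → Matrix N N ℂ) j) * NormedSpace.exp (-π (p.1 j))
  let F : DeformationParam J N K → Matrix N N ℂ × ℂ := fun p =>
    (∑ j, β p j + (p.2.1 - π p.2.1) + Δ p.2.2.1, p.2.2.2)
  let πj : J → DeformationParam J N K →L[ℂ] Matrix N N ℂ := fun j =>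
    π ∘L ContinuousLinearMap.proj j ∘L
    ContinuousLinearMap.fst ℂ (J → Matrix N N ℂ) (Matrix N N ℂ × (K → ℂ) × ℂ)
  have hπj : ∀ j (p : DeformationParam J N K), πj j p = π (p.1 j) := fun j p => rfl
  let W₁ : DeformationParam J N K →L[ℂ] Matrix N N ℂ :=
    ContinuousLinearMap.fst ℂ _ _ ∘L ContinuousLinearMap.snd ℂ _ _
  let W₂ : DeformationParam J N K →L[ℂ] (K → ℂ) :=
    ContinuousLinearMap.fst ℂ _ _ ∘L ContinuousLinearMap.snd ℂ _ _ ∘L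
    ContinuousLinearMap.snd ℂ _ _
  let W₃ : DeformationParam J N K →L[ℂ] ℂ :=
    ContinuousLinearMap.snd ℂ _ _ ∘L ContinuousLinearMap.snd ℂ _ _ ∘L
    ContinuousLinearMap.snd ℂ _ _
  have hβ : ∀ j, ∃ β' : DeformationParam J N K →L[ℂ] Matrix N N ℂ,
      HasStrictFDerivAt (fun p => β p j) β' 0 ∧
      ∀ p, β' p = π (p.1 j) * B j + p.2.2.2 • (Pi.single j₀ E : J → Matrix N N ℂ) j -
        B j * π (p.1 j) := fun j =>
    exists_hasStrictFDerivAt_exp_conj (πj j)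
      (W₃.smulRight ((Pi.single j₀ E : J → Matrix N N ℂ) j)) (B j)
  choose β' hβ' hβ'p using hβ
  let F' : DeformationParam J N K →L[ℂ] Matrix N N ℂ × ℂ :=
    (∑ j, β' j + (W₁ - π ∘L W₁) + Δ ∘L W₂).prod W₃
  have hF' : ∀ p : DeformationParam J N K,
      F' p = (∑ j, β' j p + (p.2.1 - π p.2.1) + Δ p.2.2.1, p.2.2.2) := by
    intro p
    simp [F', W₁, W₂, W₃]
  have hF : HasStrictFDerivAt F F' 0 :=
    (((HasStrictFDerivAt.fun_sum fun j _ => hβ' j).add (W₁ - π ∘L W₁).hasStrictFDerivAt).add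
      (Δ ∘L W₂).hasStrictFDerivAt).prodMk W₃.hasStrictFDerivAt
  have hF0 : F 0 = 0 := by
    simp [F, β, hsum]
  have hsurj : LinearMap.range F'.toLinearMap = ⊤ := by
    rw [LinearMap.range_eq_top]
    rintro ⟨Y, ε⟩
    obtain ⟨X, W, u, h⟩ := exists_sum_commutator_add hB hconn hs hd (Y - ε • E)
    refine ⟨(X, W, u, ε), ?_⟩
    have hsumE : ∑ j, (Pi.single j₀ E : J → Matrix N N ℂ) j = E := by
      simp
    rw [ContinuousLinearMap.coe_coe, hF', Prod.mk.injEq]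
    refine ⟨?_, rfl⟩
    have : ∑ j, β' j (X, W, u, ε) =
        ∑ j, (blockProj c (X j) * B j - B j * blockProj c (X j)) + ε • E := by
      conv_rhs => rw [← hsumE, Finset.smul_sum, ← Finset.sum_add_distrib]
      refine Finset.sum_congr rfl fun j _ => ?_
      rw [hβ'p, hπ]
      abel
    rw [this, hπ, hΔ, ← sub_eq_zero]
    rw [← sub_eq_zero] at h
    rw [← h]
    abel
  have hmap := hF.map_nhds_eq_of_surj hsurj
  rw [hF0] at hmap
  have hβc : ContinuousAt β 0 := continuousAt_pi.2 fun j => (hβ' j).continuousAt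
  have hβ0 : β 0 = B := by
    ext1 j
    simp [β]
  have hU' : β ⁻¹' U ∈ 𝓝 (0 : DeformationParam J N K) := hβc (by rwa [hβ0])
  have himg : F '' (β ⁻¹' U) ∈ 𝓝 (0 : Matrix N N ℂ × ℂ) :=
    hmap.ge (Filter.image_mem_map hU')
  have hline : Filter.Tendsto (fun ε : ℂ => ((0 : Matrix N N ℂ), ε)) (𝓝[≠] 0) (𝓝 0) :=
    ((Continuous.prodMk_right (0 : Matrix N N ℂ)).tendsto (0 : ℂ)).mono_left nhdsWithin_le_nhds
  obtain ⟨ε, ⟨⟨X, W, u, ε'⟩, hpU, hp⟩, hε⟩ :=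
    ((hline.eventually himg).and self_mem_nhdsWithin).exists
  obtain ⟨hp₁, rfl⟩ : _ = 0 ∧ ε' = ε := Prod.mk.inj hp
  have hcX : ∀ j (z : K → ℂ), Commute (π (X j)) (Matrix.diagonal fun i => z (c i)) := by
    intro j z
    rw [hπ]
    exact commute_blockProj c _ z
  have hEj : ∀ j (z : K → ℂ), Commute ((Pi.single j₀ E : J → Matrix N N ℂ) j)
      (Matrix.diagonal fun i => z (c i)) := by
    intro j z
    rcases eq_or_ne j j₀ with rfl | hj
    · simpa using hE z
    · rw [Pi.single_eq_of_ne hj]; exact Commute.zero_left _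
  have hEjtr : ∀ j (z : K → ℂ), ((Pi.single j₀ E : J → Matrix N N ℂ) j *
      (Matrix.diagonal fun i => z (c i))).trace = 0 := by
    intro j z
    rcases eq_or_ne j j₀ with rfl | hj
    · simpa using hEtr z
    · rw [Pi.single_eq_of_ne hj]; simp
  have hinv : ∀ j, NormedSpace.exp (π (X j)) * NormedSpace.exp (-π (X j)) = 1 := fun j =>
    exp_mul_exp_neg _
  have hinv' : ∀ j, NormedSpace.exp (-π (X j)) * NormedSpace.exp (π (X j)) = 1 := fun j => by
    have h := exp_mul_exp_neg (-π (X j))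
    rw [neg_neg] at h
    exact h
  have hexpz : ∀ j (z : K → ℂ), Commute (NormedSpace.exp (π (X j)))
      (Matrix.diagonal fun i => z (c i)) := fun j z => (hcX j z).exp_left
  have hexpz' : ∀ j (z : K → ℂ), Commute (NormedSpace.exp (-π (X j)))
      (Matrix.diagonal fun i => z (c i)) := fun j z => (hcX j z).neg_left.exp_left
  set p : DeformationParam J N K := (X, W, u, ε') with hp_def
  have hzero : ∑ j, β p j = 0 := by
    have hp' : ∑ j, β p j + (W - blockProj c W) + Matrix.diagonal (fun i => u (c i)) = 0 := by
      rw [← hπ, ← hΔ]; exact hp₁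
    refine eq_zero_of_add_offBlock_add_diagonal (fun z => ?_) (fun z => ?_) hp'
    · refine Commute.sum_left _ _ _ fun j _ => ?_
      exact ((hexpz j z).mul_left ((block_iff_commute.1 (hB j) z).add_left
        ((hEj j z).smul_left _))).mul_left (hexpz' j z)
    · have : ∀ j, (β p j * Matrix.diagonal fun i => z (c i)).trace =
          (B j * Matrix.diagonal fun i => z (c i)).trace := by
        intro j
        simp only [β, hp_def]
        rw [mul_assoc, (hexpz' j z).eq, mul_assoc, Matrix.trace_mul_comm, ← mul_assoc, mul_assoc,
          mul_assoc, hinv' j, mul_one, add_mul, Matrix.trace_add, smul_mul_assoc,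
          Matrix.trace_smul, hEjtr, smul_zero, add_zero]
      rw [Finset.sum_mul, Matrix.trace_sum, Finset.sum_congr rfl fun j _ => this j,
        ← Matrix.trace_sum, ← Finset.sum_mul, hsum, zero_mul, Matrix.trace_zero]
  exact ⟨ε', hε, β p, hpU, hzero, fun j => ⟨⟨_, _, hinv j, hinv' j⟩, rfl⟩⟩

omit [Fintype K] [DecidableEq K] in
/-- A diagonal matrix with distinct entries is conjugate to any of its strictly block triangular
perturbations with a single nonzero block. -/
lemma exists_diagonal_add_eq_conj {c : N → K} {d : N → ℂ} (hd : Function.Injective d) {k l : K}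
    (hkl : k ≠ l) {E : Matrix N N ℂ} (hk : ∀ i i', c i ≠ k → E i i' = 0)
    (hl : ∀ i i', c i' ≠ l → E i i' = 0) :
    ∃ g : (Matrix N N ℂ)ˣ, Matrix.diagonal d + E =
      (g : Matrix N N ℂ) * Matrix.diagonal d * (↑g⁻¹ : Matrix N N ℂ) := by
  let Y : Matrix N N ℂ := Matrix.of fun i i' => E i i' / (d i' - d i)
  have hYE : Y * Matrix.diagonal d - Matrix.diagonal d * Y = E := by
    ext i i'
    rw [Matrix.sub_apply, Matrix.mul_diagonal, Matrix.diagonal_mul]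
    change E i i' / (d i' - d i) * d i' - d i * (E i i' / (d i' - d i)) = E i i'
    by_cases hi : i = i'
    · subst hi
      by_cases h : c i = k
      · rw [hl i i (h.trans_ne hkl)]; simp
      · rw [hk i i h]; simp
    · have := sub_ne_zero.2 fun h => hi (hd h).symm
      field_simp
  have hzero : ∀ M : Matrix N N ℂ, (∀ i i', c i ≠ k → M i i' = 0) → Y * M = 0 := by
    intro M hM
    ext i i'
    rw [Matrix.mul_apply, Matrix.zero_apply]
    refine Finset.sum_eq_zero fun a _ => ?_
    by_cases ha : c a = k
    · simp [Y, hl i a (ha.trans_ne hkl)]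
    · rw [hM a i' ha, mul_zero]
  have hYY : Y * Y = 0 := hzero Y fun i i' h => by simp [Y, hk i i' h]
  have hYDY : Y * (Matrix.diagonal d * Y) = 0 := hzero _ fun i i' h => by
    simp [Y, Matrix.diagonal_mul, hk i i' h]
  refine ⟨⟨1 + Y, 1 - Y, ?_, ?_⟩, ?_⟩
  · rw [add_mul, mul_sub, mul_sub, hYY]; simp
  · rw [sub_mul, mul_add, mul_add, hYY]; simp
  · change _ = (1 + Y) * Matrix.diagonal d * (1 - Y)
    rw [mul_sub, mul_one, add_mul, one_mul, add_mul, mul_assoc, hYDY, ← hYE]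
    abel

/-- A rank one perturbation of one matrix of a tuple with zero sum, mapping one block to another,
can be realized up to conjugation by a small deformation of the tuple with zero sum. -/
lemma exists_deformation {c : N → K} {B : J → Matrix N N ℂ} {s : J} {d : N → ℂ}
    (hB : ∀ j i i', c i ≠ c i' → B j i i' = 0)
    (hconn : ∀ f : N → ℂ, (∀ j i i', B j i i' ≠ 0 → f i = f i') →
      ∃ g : K → ℂ, ∀ i, f i = g (c i))
    (hs : B s = Matrix.diagonal d) (hd : Function.Injective d) (hsum : ∑ j, B j = 0)
    {x η : N → ℂ} {k l : K} (hx : ∀ i, c i ≠ k → x i = 0) (hη : ∀ i, c i ≠ l → η i = 0)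
    (hηx : η ⬝ᵥ x = 0) {j₀ : J} (hj₀ : j₀ ≠ s) {U : Set (J → Matrix N N ℂ)} (hU : U ∈ 𝓝 B) :
    ∃ ε : ℂ, ε ≠ 0 ∧ ∃ B' ∈ U, ∑ j, B' j = 0 ∧
      ∀ j, ∃ g : (Matrix N N ℂ)ˣ, B' j = (g : Matrix N N ℂ) *
        (B j + ε • (Pi.single j₀ (Matrix.vecMulVec x η) : J → Matrix N N ℂ) j) *
          (↑g⁻¹ : Matrix N N ℂ) := by
  have hE1 : ∀ i i', c i ≠ k → Matrix.vecMulVec x η i i' = 0 := fun i i' h => by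
    rw [Matrix.vecMulVec_apply, hx i h, zero_mul]
  have hE2 : ∀ i i', c i' ≠ l → Matrix.vecMulVec x η i i' = 0 := fun i i' h => by
    rw [Matrix.vecMulVec_apply, hη i' h, mul_zero]
  by_cases hkl : k = l
  · subst hkl
    refine exists_deformation_of_commute hB hconn hs hd hsum (E := Matrix.vecMulVec x η)
      (block_iff_commute.1 fun i i' h => ?_) (fun z => ?_) j₀ hU
    · by_cases hi : c i = k
      · exact hE2 i i' fun h' => h (hi.trans h'.symm)
      · exact hE1 i i' hi
    · have : ∀ i, x i * η i * z (c i) = z k * (η i * x i) := by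
        intro i
        by_cases hi : c i = k
        · rw [hi]; ring
        · rw [hx i hi]; ring
      simp only [Matrix.trace, Matrix.diag_apply, Matrix.mul_diagonal, Matrix.vecMulVec_apply, this]
      rw [← Finset.mul_sum]
      exact mul_eq_zero_of_right _ hηx
  · let β : ℂ → J → Matrix N N ℂ := fun ε => B + ε •
      (Pi.single j₀ (Matrix.vecMulVec x η) - Pi.single s (Matrix.vecMulVec x η))
    have hβ : Continuous β := by fun_prop
    have hβ0 : β 0 = B := by simp [β]
    have hU' : ∀ᶠ ε in 𝓝[≠] (0 : ℂ), β ε ∈ U :=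
      (hβ.tendsto' 0 B hβ0).mono_left nhdsWithin_le_nhds hU
    obtain ⟨ε, hεU, hε⟩ := (hU'.and self_mem_nhdsWithin).exists
    refine ⟨ε, hε, β ε, hεU, ?_, fun j => ?_⟩
    · simp [β, Finset.sum_add_distrib, hsum, ← Finset.smul_sum]
    · by_cases hj : j = s
      · subst hj
        obtain ⟨g, hg⟩ := exists_diagonal_add_eq_conj (c := c) hd hkl
          (E := -ε • Matrix.vecMulVec x η)
          (fun i i' h => by simp [hE1 i i' h]) (fun i i' h => by simp [hE2 i i' h])
        refine ⟨g, ?_⟩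
        simp only [β, Pi.add_apply, Pi.smul_apply, Pi.sub_apply, Pi.single_eq_same,
          Pi.single_eq_of_ne hj₀.symm, zero_sub, smul_zero, add_zero]
        rw [hs, ← hg, neg_smul, smul_neg]
      · exact ⟨1, by simp [β, Pi.single_eq_of_ne hj]⟩

end Deformation

section Closure

variable {N : Type*} [Fintype N] [DecidableEq N]

omit [DecidableEq N] in
lemma isClosed_setOf_rank_le (r : ℕ) : IsClosed {T : Matrix N N ℂ | T.rank ≤ r} := by
  classical
  let L : Matrix N N ℂ →ₗ[ℂ] ((N → ℂ) →L[ℂ] (N → ℂ)) :=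
    LinearMap.toContinuousLinearMap.toLinearMap ∘ₗ Matrix.toLin'.toLinearMap
  have hL : Continuous L := L.continuous_of_finiteDimensional
  have h : {T : Matrix N N ℂ | T.rank ≤ r} =
      (L ⁻¹' {f | ((r + 1 : ℕ) : Cardinal) ≤ (f : (N → ℂ) →ₗ[ℂ] (N → ℂ)).rank})ᶜ := by
    ext T
    have hT : (T.rank : Cardinal) =
        ((L T : (N → ℂ) →L[ℂ] (N → ℂ)) : (N → ℂ) →ₗ[ℂ] (N → ℂ)).rank := by
      rw [Matrix.rank_eq_finrank_range_toLin _ (Pi.basisFun ℂ N) (Pi.basisFun ℂ N)]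
      exact Module.finrank_eq_rank _ _
    rw [Set.mem_compl_iff, Set.mem_preimage, Set.mem_ofPred_eq, Set.mem_ofPred_eq, ← hT,
      Nat.cast_le, not_le, Nat.lt_succ_iff]
  rw [h]
  exact ((isOpen_setOfPred_nat_le_rank _).preimage hL).isClosed_compl

lemma isClosed_setOf_powRank_le (μ : ℂ) (i r : ℕ) :
    IsClosed {M : Matrix N N ℂ | powRank M μ i ≤ r} :=
  (isClosed_setOf_rank_le r).preimage ((continuous_id.sub continuous_const).pow i)

lemma powRank_antitone (M : Matrix N N ℂ) (μ : ℂ) : Antitone (powRank M μ) := by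
  refine antitone_nat_of_succ_le fun i => ?_
  rw [powRank, powRank, pow_succ]
  exact Matrix.rank_mul_le_left _ _

lemma powRank_eq_card_of_eval_charpoly_ne_zero {M : Matrix N N ℂ} {μ : ℂ}
    (h : M.charpoly.eval μ ≠ 0) (i : ℕ) : powRank M μ i = Fintype.card N := by
  refine Matrix.rank_of_isUnit _ (IsUnit.pow i ?_)
  rw [Matrix.eval_charpoly, ← isUnit_iff_ne_zero, ← Matrix.isUnit_iff_isUnit_det] at h
  rw [← neg_sub, IsUnit.neg_iff, Matrix.smul_one_eq_diagonal]
  exact h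

lemma powRank_add_rootMultiplicity (M : Matrix N N ℂ) (μ : ℂ) {i : ℕ} (hi : Fintype.card N ≤ i) :
    powRank M μ i + M.charpoly.rootMultiplicity μ = Fintype.card N := by
  have hN : Module.finrank ℂ (N → ℂ) = Fintype.card N := Module.finrank_fintype_fun_eq_card ℂ
  have hker : LinearMap.ker ((Matrix.toLin' M - μ • 1) ^ i) =
      Module.End.maxGenEigenspace (Matrix.toLin' M) μ := by
    rw [Module.End.maxGenEigenspace_eq_genEigenspace_finrank,
      ← Module.End.genEigenspace_eq_genEigenspace_finrank_of_le _ _ (hN.trans_le hi),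
      Module.End.genEigenspace_nat]
  rw [powRank_eq_finrank_range, ← Matrix.charpoly_toLin', ← LinearMap.finrank_maxGenEigenspace_eq,
    ← hker, LinearMap.finrank_range_add_finrank_ker, hN]

/-- A matrix with distinct eigenvalues is diagonalizable. -/
lemma exists_eq_conj_diagonal {M : Matrix N N ℂ} {d : N → ℂ} (hd : Function.Injective d)
    (h : M.charpoly = ∏ i, (X - C (d i))) :
    ∃ g : (Matrix N N ℂ)ˣ, M = (g : Matrix N N ℂ) * Matrix.diagonal d * (↑g⁻¹ : Matrix N N ℂ) := by
  have hev : ∀ i, Module.End.HasEigenvalue (Matrix.toLin' M) (d i) := fun i => by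
    rw [Module.End.hasEigenvalue_iff_isRoot_charpoly, Matrix.charpoly_toLin', h,
      Polynomial.IsRoot, Polynomial.eval_prod]
    exact Finset.prod_eq_zero (Finset.mem_univ i) (by simp)
  choose v hv using fun i => (hev i).exists_hasEigenvector
  have hli := Module.End.eigenvectors_linearIndependent' _ d hd v hv
  have hunit : IsUnit (Matrix.of fun i j => v j i) :=
    Matrix.linearIndependent_cols_iff_isUnit.1 hli
  refine ⟨hunit.unit, ?_⟩
  rw [Units.eq_mul_inv_iff_mul_eq, IsUnit.unit_spec]
  ext i j
  rw [Matrix.mul_diagonal, Matrix.of_apply, mul_comm]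
  exact congrFun (hv j).apply_eq_smul i

variable {n : ℕ} {A M : Matrix (Fin n) (Fin n) ℂ}

lemma powRank_le_of_mem_closure (h : M ∈ closure (conjClass A)) (μ : ℂ) (i : ℕ) :
    powRank M μ i ≤ powRank A μ i :=
  closure_minimal (by rintro _ ⟨g, rfl⟩; exact (powRank_units_conj g A μ i).le)
    (isClosed_setOf_powRank_le μ i (powRank A μ i)) h

lemma charpoly_eq_of_mem_closure (h : M ∈ closure (conjClass A)) : M.charpoly = A.charpoly := by
  refine Polynomial.funext fun t => ?_
  simp only [Matrix.eval_charpoly]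
  have hc : IsClosed {M : Matrix (Fin n) (Fin n) ℂ |
      (Matrix.scalar (Fin n) t - M).det = (Matrix.scalar (Fin n) t - A).det} :=
    isClosed_eq (continuous_const.sub continuous_id).matrix_det continuous_const
  refine closure_minimal ?_ hc h
  rintro _ ⟨g, rfl⟩
  rw [Set.mem_ofPred_eq, ← Matrix.eval_charpoly, ← Matrix.eval_charpoly, Matrix.coe_units_inv,
    Matrix.charpoly_units_conj]

end Closure

section Main

open Topology

variable {N : Type} [Fintype N] [DecidableEq N] {J : Type*} [Fintype J] [DecidableEq J]

/-- The ranks of the powers of the translates of the matrices `B j` are dominated by those of the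
matrices `A j`, while the generalized eigenspaces have the same dimensions; the matrices `B j` have
zero sum and `B s` is conjugate to the diagonal matrix `d`. -/
structure RankDominated (A : J → Matrix N N ℂ) (s : J) (d : N → ℂ) (B : J → Matrix N N ℂ) :
    Prop where
  sum_eq : ∑ j, B j = 0
  le : ∀ j μ i, powRank (B j) μ i ≤ powRank (A j) μ i
  eq_of_le : ∀ j μ i, Fintype.card N ≤ i → powRank (B j) μ i = powRank (A j) μ i
  conj : ∃ g : (Matrix N N ℂ)ˣ,
    B s = (g : Matrix N N ℂ) * Matrix.diagonal d * (↑g⁻¹ : Matrix N N ℂ)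

/-- The exponents and eigenvalues relevant for the matrices `A j`. -/
def rankIndices (A : J → Matrix N N ℂ) : Finset (Σ _ : J, ℂ × ℕ) :=
  Finset.univ.sigma fun j => (A j).charpoly.roots.toFinset ×ˢ Finset.range (Fintype.card N)

omit [DecidableEq J] in
lemma RankDominated.mem_rankIndices {A B : J → Matrix N N ℂ} {s : J} {d : N → ℂ}
    (h : RankDominated A s d B) {j : J} {μ : ℂ} {i : ℕ}
    (hlt : powRank (B j) μ i < powRank (A j) μ i) : ⟨j, μ, i⟩ ∈ rankIndices A := by
  have hi : i < Fintype.card N := by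
    by_contra hi
    exact hlt.ne (h.eq_of_le j μ i (not_lt.1 hi))
  have hμ : (A j).charpoly.eval μ = 0 := by
    by_contra hμ
    have h1 := h.eq_of_le j μ (Fintype.card N) le_rfl
    rw [powRank_eq_card_of_eval_charpoly_ne_zero hμ] at h1 hlt
    exact (hlt.trans_eq h1.symm).not_ge (powRank_antitone _ _ hi.le)
  simp [rankIndices, hi, hμ, Polynomial.mem_roots', (A j).charpoly_monic.ne_zero]

/-- If the ranks are strictly dominated somewhere, the tuple can be deformed in order to increase
the ranks. -/
lemma RankDominated.exists_step {A B : J → Matrix N N ℂ} {s : J} {d : N → ℂ}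
    (hd : Function.Injective d) (h : RankDominated A s d B)
    (hs : ∀ μ i, powRank (B s) μ i = powRank (A s) μ i) {j₀ : J} {μ : ℂ} {i : ℕ}
    (hlt : powRank (B j₀) μ i < powRank (A j₀) μ i) {U : Set (J → Matrix N N ℂ)} (hU : U ∈ 𝓝 B) :
    ∃ B' ∈ U, RankDominated A s d B' ∧ (∀ j μ i, powRank (B j) μ i ≤ powRank (B' j) μ i) ∧
      ∃ j μ i, powRank (B j) μ i < powRank (B' j) μ i := by
  classical
  obtain ⟨g, hg⟩ := h.conj
  let Φ : (J → Matrix N N ℂ) → J → Matrix N N ℂ := fun B j =>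
    (g : Matrix N N ℂ) * B j * (↑g⁻¹ : Matrix N N ℂ)
  have hΦ : Continuous Φ := continuous_pi fun j =>
    (continuous_const.mul (continuous_apply j)).mul continuous_const
  let D : J → Matrix N N ℂ := fun j => (↑g⁻¹ : Matrix N N ℂ) * B j * (g : Matrix N N ℂ)
  have hΦD : Φ D = B := by
    ext1 j
    simp [Φ, D, mul_assoc]
  have hDrank : ∀ j μ i, powRank (D j) μ i = powRank (B j) μ i := by
    intro j μ i
    rw [← hΦD, powRank_units_conj]
  have hDs : D s = Matrix.diagonal d := by
    simp [D, hg, mul_assoc]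
  have hDsum : ∑ j, D j = 0 := by
    simp only [D]
    rw [← Finset.sum_mul, ← Finset.mul_sum, h.sum_eq, mul_zero, zero_mul]
  let r : N → N → Prop := fun a b => ∃ j, D j a b ≠ 0
  let c : N → Quot r := Quot.mk r
  have : Fintype (Quot r) := Fintype.ofFinite _
  have hblock : ∀ j a b, c a ≠ c b → D j a b = 0 := fun j a b hab => by
    by_contra hne
    exact hab (Quot.sound ⟨j, hne⟩)
  have hconn : ∀ f : N → ℂ, (∀ j a b, D j a b ≠ 0 → f a = f b) →
      ∃ f' : Quot r → ℂ, ∀ a, f a = f' (c a) := fun f hf =>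
    ⟨Quot.lift f fun a b ⟨j, hj⟩ => hf j a b hj, fun _ => rfl⟩
  have hj₀ : j₀ ≠ s := by
    rintro rfl
    exact hlt.ne (hs μ i)
  obtain ⟨x, η, k, l, hx, hη, hηx, hε⟩ := exists_vecMulVec_powRank (A := A j₀) (hblock j₀)
    (fun μ i => (hDrank j₀ μ i).trans_le (h.le j₀ μ i))
    (fun μ i hi => (hDrank j₀ μ i).trans (h.eq_of_le j₀ μ i hi))
    ⟨μ, i, (hDrank j₀ μ i).trans_lt hlt⟩
  obtain ⟨ε, hε0, D', hD'U, hD'sum, hD'⟩ := exists_deformation hblock hconn hDs hd hDsum hx hη hηx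
    hj₀ (U := Φ ⁻¹' U) (hΦ.continuousAt.preimage_mem_nhds (by rwa [hΦD]))
  obtain ⟨hle, hle', μ', i', hlt'⟩ := hε ε hε0
  have hrank : ∀ j, j ≠ j₀ → ∀ μ i, powRank (Φ D' j) μ i = powRank (B j) μ i := by
    intro j hj μ i
    obtain ⟨g', hg'⟩ := hD' j
    rw [powRank_units_conj, hg', powRank_units_conj, Pi.single_eq_of_ne hj, smul_zero, add_zero,
      hDrank]
  have hrank₀ : ∀ μ i, powRank (Φ D' j₀) μ i =
      powRank (D j₀ + ε • Matrix.vecMulVec x η) μ i := by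
    intro μ i
    obtain ⟨g', hg'⟩ := hD' j₀
    rw [powRank_units_conj, hg', powRank_units_conj, Pi.single_eq_same]
  have hmono : ∀ j μ i, powRank (B j) μ i ≤ powRank (Φ D' j) μ i := by
    intro j μ i
    by_cases hj : j = j₀
    · subst hj
      rw [hrank₀, ← hDrank]
      exact hle μ i
    · exact (hrank j hj μ i).ge
  have hmono' : ∀ j μ i, powRank (Φ D' j) μ i ≤ powRank (A j) μ i := by
    intro j μ i
    by_cases hj : j = j₀
    · subst hj
      rw [hrank₀]
      exact hle' μ i
    · exact (hrank j hj μ i).trans_le (h.le j μ i)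
  refine ⟨Φ D', hD'U, ⟨?_, hmono', fun j μ i hi => ?_, ?_⟩, hmono, j₀, μ', i', ?_⟩
  · simp only [Φ]
    rw [← Finset.sum_mul, ← Finset.mul_sum, hD'sum, mul_zero, zero_mul]
  · exact le_antisymm (hmono' j μ i) ((h.eq_of_le j μ i hi).ge.trans (hmono j μ i))
  · obtain ⟨g', hg'⟩ := hD' s
    refine ⟨g * g', ?_⟩
    simp only [Φ]
    rw [hg', Pi.single_eq_of_ne hj₀.symm, smul_zero, add_zero, hDs, _root_.mul_inv_rev,
      Units.val_mul, Units.val_mul]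
    simp only [mul_assoc]
  · rw [hrank₀, ← hDrank]
    exact hlt'

/-- A tuple with dominated ranks lies in the closure of the tuples of zero sum of matrices which
are conjugate to the given ones. -/
lemma RankDominated.mem_closure {A : J → Matrix N N ℂ} {s : J} {d : N → ℂ}
    (hd : Function.Injective d)
    (hA : ∃ g : (Matrix N N ℂ)ˣ,
      A s = (g : Matrix N N ℂ) * Matrix.diagonal d * (↑g⁻¹ : Matrix N N ℂ))
    {B : J → Matrix N N ℂ} (h : RankDominated A s d B) :
    B ∈ closure {B : J → Matrix N N ℂ | (∀ j, ∃ g : (Matrix N N ℂ)ˣ,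
      B j = (g : Matrix N N ℂ) * A j * (↑g⁻¹ : Matrix N N ℂ)) ∧ ∑ j, B j = 0} := by
  induction hm : ∑ t ∈ rankIndices A, (powRank (A t.1) t.2.1 t.2.2 - powRank (B t.1) t.2.1 t.2.2)
    using Nat.strong_induction_on generalizing B with
  | _ m ih =>
    by_cases heq : ∀ j μ i, powRank (A j) μ i = powRank (B j) μ i
    · exact subset_closure ⟨fun j => exists_units_conj_of_powRank_eq (heq j), h.sum_eq⟩
    push Not at heq
    obtain ⟨j₀, μ, i, hne⟩ := heq
    have hs : ∀ μ i, powRank (B s) μ i = powRank (A s) μ i := by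
      intro μ i
      obtain ⟨g, hg⟩ := h.conj
      obtain ⟨g', hg'⟩ := hA
      rw [hg, hg', powRank_units_conj, powRank_units_conj]
    rw [← closure_closure, mem_closure_iff_nhds]
    intro U hU
    obtain ⟨B', hB'U, hB', hle, j, ν, q, hlt⟩ :=
      h.exists_step hd hs (lt_of_le_of_ne (h.le j₀ μ i) hne.symm) hU
    refine ⟨B', hB'U, ih _ ?_ hB' rfl⟩
    rw [← hm]
    refine Finset.sum_lt_sum (fun t _ => Nat.sub_le_sub_left (hle _ _ _) _)
      ⟨⟨j, ν, q⟩, h.mem_rankIndices (hlt.trans_le (hB'.le j ν q)), ?_⟩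
    exact Nat.sub_lt_sub_left (hlt.trans_le (hB'.le j ν q)) hlt

end Main

/-- a tuple from the algebraic closure of 𝒱 lies in the topological
closure of 𝒱 (it can be continuously deformed into a tuple from 𝒱). -/
theorem stmt19 (p n : ℕ) (hp : 2 ≤ p) (hn : 1 ≤ n)
    (A : Fin (p + 1) → Matrix (Fin n) (Fin n) ℂ)
    (htr : ∑ j, (A j).trace = 0)
    (hdist : HasDistinctEigen (A (Fin.last p)))
    (B : Fin (p + 1) → Matrix (Fin n) (Fin n) ℂ)
    (hB : ∀ j, B j ∈ closure (conjClass (A j)))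
    (hsum : ∑ j, B j = 0) :
    B ∈ closure (Vset A) := by
  obtain ⟨d, hd, hchar⟩ := hdist
  have hchar' := fun j => charpoly_eq_of_mem_closure (hB j)
  refine RankDominated.mem_closure hd (exists_eq_conj_diagonal hd hchar)
    ⟨hsum, fun j μ i => powRank_le_of_mem_closure (hB j) μ i, fun j μ i hi => ?_,
      exists_eq_conj_diagonal hd ((hchar' _).trans hchar)⟩
  have h1 := powRank_add_rootMultiplicity (B j) μ hi
  have h2 := powRank_add_rootMultiplicity (A j) μ hi
  rw [hchar' j] at h1
  omega
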